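/- arXiv:1802.02454 — 2 statements merged into one kernel-verified Lean document; each statement's English description precedes it below -/
import Mathlib

section
/- The Lagrange spectrum L is disjoint from the open interval (c_inf, C_inf), i.e., L ∩ (c_inf, C_inf) = empty set. -/
open Filter Set

/-- Convergents of the continued fraction `[a 0; a 1, a 2, ...]`. -/
noncomputable def cfConv : (ℕ → ℕ) → ℕ → ℝ
  | a, 0 => (a 0 : ℝ)
  | a, n + 1 => (a 0 : ℝ) + 1 / cfConv (fun i => a (i + 1)) n

/-- Value of the infinite continued fraction `[a 0; a 1, a 2, ...]`,
i.e. the limit of its convergents. -/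
noncomputable def cfVal (a : ℕ → ℕ) : ℝ := limUnder atTop (cfConv a)

/-- Value of the infinite continued fraction `[0; g 0, g 1, g 2, ...]`. -/
noncomputable def cf0 (g : ℕ → ℕ) : ℝ :=
  cfVal (fun n => match n with | 0 => 0 | k + 1 => g k)

/-- `λ_i(A) = [a_i; a_{i+1}, ...] + [0; a_{i-1}, a_{i-2}, ...]` for a bi-infinite
sequence `A`. -/
noncomputable def lam (A : ℤ → ℕ) (i : ℤ) : ℝ :=
  cfVal (fun n => A (i + n)) + cf0 (fun k => A (i - 1 - k))

/-- The Markov value `m(A) = sup_i λ_i(A)`. -/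
noncomputable def markovVal (A : ℤ → ℕ) : ℝ := sSup (Set.range (lam A))

/-- The Lagrange value `ℓ(A) = limsup_{i → +∞} λ_i(A)`. -/
noncomputable def lagrangeVal (A : ℤ → ℕ) : ℝ := limsup (lam A) atTop

/-- The Markov spectrum (Perron's characterization). -/
def MarkovSpectrum : Set ℝ :=
  {x | ∃ A : ℤ → ℕ, (∀ n, 0 < A n) ∧ BddAbove (Set.range (lam A)) ∧ x = markovVal A}

/-- The Lagrange spectrum (Perron's characterization). -/
def LagrangeSpectrum : Set ℝ :=
  {x | ∃ A : ℤ → ℕ, (∀ n, 0 < A n) ∧ IsBoundedUnder (· ≤ ·) atTop (lam A) ∧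
    x = lagrangeVal A}

/-- The purely periodic one-sided sequence with period `w`. -/
def perSeq (w : List ℕ) : ℕ → ℕ := fun n => w.getD (n % w.length) 1

/-- The one-sided sequence beginning with the finite word `p` and continuing with `g`. -/
def catSeq (p : List ℕ) (g : ℕ → ℕ) : ℕ → ℕ :=
  fun n => if n < p.length then p.getD n 1 else g (n - p.length)

/-- The eventually periodic one-sided sequence with preperiod `p` and period `w`. -/
def prePer (p w : List ℕ) : ℕ → ℕ := catSeq p (perSeq w)

/-- The periodic bi-infinite sequence with period `w`. -/
def perZ (w : List ℕ) : ℤ → ℕ := fun n => w.getD ((n % (w.length : ℤ)).toNat) 1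

/-- `c_∞ = [overline(2_4 1_2 2_2 1)] + [0; overline(1 2_2 1_2 2_4)]`. -/
noncomputable def cInf : ℝ :=
  cfVal (perSeq [2,2,2,2,1,1,2,2,1]) + cf0 (perSeq [1,2,2,1,1,2,2,2,2])

/-- `C_∞ = [2; 1, 2_2, 1_2, 2_4, 1, 2_2, 1_2, 2_4, 1, 2_2, 1_2, 2_2, 1, 2_4, 1_2,
overline(2_3 1_3)] + [0; 2_3, 1_2, 2_2, 1, 2_4, 1, overline(1_3 2_3)]`. -/
noncomputable def CInf : ℝ :=
  cfVal (prePer [2,1,2,2,1,1,2,2,2,2,1,2,2,1,1,2,2,2,2,1,2,2,1,1,2,2,1,2,2,2,2,1,1]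
    [2,2,2,1,1,1]) +
  cf0 (prePer [2,2,2,1,1,2,2,1,2,2,2,2,1] [1,1,1,2,2,2])

/-- `f = [overline(2_4 1_2 2_2 1)] + [0; 1, 2_2, 1_2, 2_4, 1, 2_2, 1_2, 2_2, 1_2,
overline(2_3 1_3)]`. -/
noncomputable def fV : ℝ :=
  cfVal (perSeq [2,2,2,2,1,1,2,2,1]) +
  cf0 (prePer [1,2,2,1,1,2,2,2,2,1,2,2,1,1,2,2,1,1] [2,2,2,1,1,1])

/-- `w` occurs in the bi-infinite sequence `A` starting at position `j`. -/
def occursAtZ (w : List ℕ) (A : ℤ → ℕ) (j : ℤ) : Prop :=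
  ∀ i : ℕ, i < w.length → A (j + i) = w.getD i 0

/-- `w` occurs somewhere in the bi-infinite sequence `A`. -/
def occursInZ (w : List ℕ) (A : ℤ → ℕ) : Prop := ∃ j : ℤ, occursAtZ w A j

/-- `w` occurs in the one-sided sequence `g` starting at position `k`. -/
def occursAtN (w : List ℕ) (g : ℕ → ℕ) (k : ℕ) : Prop :=
  ∀ i : ℕ, i < w.length → g (k + i) = w.getD i 0

/-- `w` occurs somewhere in the one-sided sequence `g`. -/
def occursInN (w : List ℕ) (g : ℕ → ℕ) : Prop := ∃ k : ℕ, occursAtN w g k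

def W1 : List ℕ := [1,2,1]
def W2 : List ℕ := [2,2,1,2,2,2,1]
def W3 : List ℕ := [2,2,2,1,2,2,2]
def W4 : List ℕ := [2,2,2,2,2,1,2,2,1,1]
def W5 : List ℕ := [2,2,2,1,1,2,2,2,2,1,2,2,1,1,2,2,2]
def W6 : List ℕ := [2,2,1,1,2,2,2,2,1,2,2,1,1,2,2,2,1]
def W7 : List ℕ := [1,1,2,2,1,1,2,2,2,2,1,2,2,1,1,2,2,2]
def W8 : List ℕ := [2,2,1,2,2,1,1,2,2,2,2,1,2,2,1,1,2,2,2,2,2]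
def W9 : List ℕ := [1,2,2,1,2,2,1,1,2,2,2,2,1,2,2,1,1,2,2,2,2,1]
def W10 : List ℕ := [2,2,2,2,1,2,2,1,1,2,2,2,2,1,2,2,1,1,2,2,2,2,1,1]
def W11 : List ℕ := [2,2,2,2,1,2,2,1,1,2,2,2,2,1,2,2,1,1,2,2,2,2,1,2,2,1,2]
def W12 : List ℕ := [1,2,2,2,2,1,2,2,1,1,2,2,2,2,1,2,2,1,1,2,2,2,2,1,2,2,1,1,1]
def W13 : List ℕ := [2,1,2,2,2,2,1,2,2,1,1,2,2,2,2,1,2,2,1,1,2,2,2,2,1,2,2,1,1,2,2]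

/-- The list of the thirteen words `W_1, …, W_13`. -/
def Wall : List (List ℕ) := [W1,W2,W3,W4,W5,W6,W7,W8,W9,W10,W11,W12,W13]

/-- The words `W_1, …, W_13` together with the (0-based) position of their marked
digit `2^*`. -/
def markedW : List (List ℕ × ℕ) :=
  [(W1,1),(W2,3),(W3,4),(W4,4),(W5,8),(W6,7),(W7,9),(W8,10),(W9,11),(W10,12),
   (W11,12),(W12,13),(W13,14)]

/-- The words `V_15, …, V_21` together with the (0-based) position of their marked
digit `2^*`. -/
def markedV : List (List ℕ × ℕ) :=
  [([1,1,2,2],2),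
   ([2,2,1,2,2,1],3),
   ([2,2,2,2,1,2,2,1,2],3),
   ([1,2,2,2,2,1,2,2,1,1,1],4),
   ([1,2,2,2,2,1,2,2,1,1,2,2,1],4),
   ([2,1,2,2,2,2,1,2,2,1,1,2,2,2],5),
   ([1,1,1,2,2,2,2,1,2,2,1,1,2,2,2],6)]

/-- The word `2 1_2 2_4 1 2_2 1_2 2_3`. -/
def spWord : List ℕ := [2,1,1,2,2,2,2,1,2,2,1,1,2,2,2]

/-- The set `P` of 27 forbidden words: `W_1, …, W_13`, their transposes, and
`2 1_2 2_4 1 2_2 1_2 2_3` together with its transpose. -/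
def Pwords : List (List ℕ) := Wall ++ Wall.map List.reverse ++ [spWord, spWord.reverse]

/-- `g` contains no word of `P` as a consecutive subword. -/
def avoidsP (g : ℕ → ℕ) : Prop := ∀ w ∈ Pwords, ¬ occursInN w g

/-- The Cantor set `Y`. -/
noncomputable def Yset : Set ℝ :=
  {x | ∃ g : ℕ → ℕ, (∀ n, g n = 1 ∨ g n = 2) ∧ avoidsP g ∧ x = cf0 g}

/-- The word `1_2 2_4 1 2_2 1_2 2_4 1 2_2 1_2 2_4 1 2_2 1_2 2_2`. -/
def bigWord : List ℕ :=
  [1,1,2,2,2,2,1,2,2,1,1,2,2,2,2,1,2,2,1,1,2,2,2,2,1,2,2,1,1,2,2]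

/-- The word `1_3 2_4 1 2_2 1_2 2_4 1 2_2 1_2 2_4 1 2_2 1_2 2_2`. -/
def bigWord13 : List ℕ := 1 :: bigWord

/-- `g` is an infinite concatenation of the blocks `(1,1)` and `(2,2)`. -/
def isBlockSeq (g : ℕ → ℕ) : Prop :=
  ∀ n, (g (2*n) = 1 ∧ g (2*n+1) = 1) ∨ (g (2*n) = 2 ∧ g (2*n+1) = 2)

/-- The Gauss–Cantor set `K({1_2, 2_2})`. -/
noncomputable def Kset : Set ℝ := {x | ∃ g : ℕ → ℕ, isBlockSeq g ∧ x = cf0 g}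

/-! ### Continued fraction values -/

/-- The shift of a one-sided sequence. -/
def shiftSeq (a : ℕ → ℕ) : ℕ → ℕ := fun n => a (n + 1)

theorem one_le_cfConv : ∀ (n : ℕ) (a : ℕ → ℕ), (∀ k, 0 < a k) → 1 ≤ cfConv a n
  | 0, a, ha => by
      have := ha 0
      simp only [cfConv]
      exact_mod_cast this
  | n + 1, a, ha => by
      have h1 := one_le_cfConv n (fun i => a (i + 1)) (fun k => ha (k + 1))
      have h0 : (1 : ℝ) ≤ a 0 := by exact_mod_cast ha 0
      have : 0 < 1 / cfConv (fun i => a (i + 1)) n := by positivity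
      simp only [cfConv]
      linarith

theorem cfConv_mem_Icc (n : ℕ) (a : ℕ → ℕ) (ha : ∀ k, 0 < a (k + 1)) :
    cfConv a n ∈ Icc (a 0 : ℝ) (a 0 + 1) := by
  cases n with
  | zero => simp [cfConv]
  | succ n =>
      have h1 := one_le_cfConv n (fun i => a (i + 1)) ha
      have h2 : 1 / cfConv (fun i => a (i + 1)) n ≤ 1 := by
        rw [div_le_one (by linarith)]; exact h1
      have h3 : 0 < 1 / cfConv (fun i => a (i + 1)) n := by positivity
      simp only [cfConv, mem_Icc]
      constructor <;> linarith

theorem abs_two_step_le {p u v : ℝ} (c : ℝ) (hp : 1 ≤ p) (hu : 1 ≤ u) (hv : 1 ≤ v) :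
    |(c + 1 / (p + 1 / u)) - (c + 1 / (p + 1 / v))| ≤ |u - v| / 4 := by
  have e : (c + 1 / (p + 1 / u)) - (c + 1 / (p + 1 / v))
      = (u - v) / ((p * u + 1) * (p * v + 1)) := by
    have : p * u + 1 ≠ 0 := by positivity
    have : p * v + 1 ≠ 0 := by positivity
    field_simp
    ring
  have h1 : 2 ≤ p * u + 1 := by nlinarith
  have h2 : 2 ≤ p * v + 1 := by nlinarith
  rw [e, abs_div, abs_of_pos (a := (p * u + 1) * (p * v + 1)) (by positivity)]
  exact div_le_div_of_nonneg_left (abs_nonneg _) (by norm_num) (by nlinarith)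

theorem abs_cfConv_sub_le : ∀ (k : ℕ) (a : ℕ → ℕ), (∀ i, 0 < a (i + 1)) → ∀ n m,
    2 * k ≤ n → 2 * k ≤ m → |cfConv a n - cfConv a m| ≤ (1 / 4) ^ k
  | 0, a, ha, n, m, _, _ => by
      have h1 := cfConv_mem_Icc n a ha
      have h2 := cfConv_mem_Icc m a ha
      rw [mem_Icc] at h1 h2
      rw [pow_zero, abs_le]
      constructor <;> linarith
  | k + 1, a, ha, n, m, hn, hm => by
      obtain ⟨n, rfl⟩ : ∃ n', n = n' + 2 := ⟨n - 2, by omega⟩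
      obtain ⟨m, rfl⟩ : ∃ m', m = m' + 2 := ⟨m - 2, by omega⟩
      have ih := abs_cfConv_sub_le k (fun i => a (i + 1 + 1)) (fun i => ha (i + 1 + 1)) n m
        (by omega) (by omega)
      have hp : (1 : ℝ) ≤ a (0 + 1) := by exact_mod_cast ha 0
      simp only [cfConv]
      refine (abs_two_step_le _ hp (one_le_cfConv n _ fun i => ha (i + 1))
        (one_le_cfConv m _ fun i => ha (i + 1))).trans ?_
      rw [pow_succ]
      linarith

theorem tendsto_cfConv (a : ℕ → ℕ) (ha : ∀ i, 0 < a (i + 1)) :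
    Tendsto (cfConv a) atTop (nhds (cfVal a)) := by
  have hc : CauchySeq (cfConv a) := by
    rw [Metric.cauchySeq_iff]
    intro ε hε
    obtain ⟨k, hk⟩ := exists_pow_lt_of_lt_one hε (by norm_num : (1 / 4 : ℝ) < 1)
    exact ⟨2 * k, fun m hm n hn => (abs_cfConv_sub_le k a ha m n hm hn).trans_lt hk⟩
  exact (cauchySeq_tendsto_of_complete hc).elim fun x hx => by
    rw [cfVal, hx.limUnder_eq]; exact hx

theorem cfVal_mem_Icc (a : ℕ → ℕ) (ha : ∀ k, 0 < a (k + 1)) :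
    cfVal a ∈ Icc (a 0 : ℝ) (a 0 + 1) :=
  isClosed_Icc.mem_of_tendsto (tendsto_cfConv a ha)
    (Eventually.of_forall fun n => cfConv_mem_Icc n a ha)

theorem one_le_cfVal (a : ℕ → ℕ) (ha : ∀ k, 0 < a k) : 1 ≤ cfVal a := by
  have h := (cfVal_mem_Icc a fun k => ha (k + 1)).1
  have : (1 : ℝ) ≤ a 0 := by exact_mod_cast ha 0
  linarith

theorem cfVal_eq (a : ℕ → ℕ) (ha : ∀ k, 0 < a (k + 1)) :
    cfVal a = a 0 + 1 / cfVal (shiftSeq a) := by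
  have h1 := (tendsto_add_atTop_iff_nat 1).2 (tendsto_cfConv a ha)
  have h2 := tendsto_cfConv (shiftSeq a) (fun k => ha (k + 1))
  have h3 := one_le_cfVal (shiftSeq a) ha
  refine tendsto_nhds_unique h1 ?_
  exact (tendsto_const_nhds.div h2 (by linarith)).const_add _

theorem cf0_eq (g : ℕ → ℕ) (hg : ∀ k, 0 < g k) : cf0 g = 1 / cfVal g := by
  rw [cf0, cfVal_eq _ (fun k => hg k)]
  simp only [CharP.cast_eq_zero, zero_add]
  rfl

theorem abs_cfVal_sub_le : ∀ (k : ℕ) (a b : ℕ → ℕ), (∀ i, 0 < a i) → (∀ i, 0 < b i) →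
    (∀ i ≤ 2 * k, a i = b i) → |cfVal a - cfVal b| ≤ (1 / 4) ^ k
  | 0, a, b, ha, hb, h => by
      have h1 := cfVal_mem_Icc a fun k => ha (k + 1)
      have h2 := cfVal_mem_Icc b fun k => hb (k + 1)
      rw [h 0 le_rfl] at h1
      rw [mem_Icc] at h1 h2
      rw [pow_zero, abs_le]
      constructor <;> linarith
  | k + 1, a, b, ha, hb, h => by
      have ih := abs_cfVal_sub_le k (shiftSeq (shiftSeq a)) (shiftSeq (shiftSeq b))
        (fun i => ha _) (fun i => hb _) (fun i hi => h (i + 1 + 1) (by omega))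
      have hp : (1 : ℝ) ≤ b 1 := by exact_mod_cast hb 1
      have e1 : shiftSeq a 0 = b 1 := h 1 (by omega)
      have e2 : shiftSeq b 0 = b 1 := rfl
      rw [cfVal_eq a fun k => ha _, cfVal_eq (shiftSeq a) fun k => ha _,
        cfVal_eq b fun k => hb _, cfVal_eq (shiftSeq b) fun k => hb _, h 0 (by omega), e1, e2]
      refine (abs_two_step_le _ hp (one_le_cfVal (shiftSeq (shiftSeq a)) fun i => ha _)
        (one_le_cfVal (shiftSeq (shiftSeq b)) fun i => hb _)).trans ?_
      rw [pow_succ]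
      linarith

/-- Comparison of two continued fractions at the first place where they differ. -/
theorem cfVal_le_of_first_difference : ∀ (n : ℕ) (a b : ℕ → ℕ), (∀ i, 0 < a i) →
    (∀ i, 0 < b i) → (∀ i < n, a i = b i) →
    (if n % 2 = 0 then a n < b n else b n < a n) → cfVal a ≤ cfVal b
  | 0, a, b, ha, hb, _, hn => by
      have h1 := (cfVal_mem_Icc a fun k => ha (k + 1)).2
      have h2 := (cfVal_mem_Icc b fun k => hb (k + 1)).1
      have : (a 0 : ℝ) + 1 ≤ b 0 := by exact_mod_cast (by simpa using hn : a 0 < b 0)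
      linarith
  | n + 1, a, b, ha, hb, h, hn => by
      have ih := cfVal_le_of_first_difference n (shiftSeq b) (shiftSeq a) (fun i => hb _)
        (fun i => ha _) (fun i hi => (h (i + 1) (by omega)).symm) (by
          simp only [shiftSeq]
          split_ifs at hn ⊢ <;> omega)
      rw [cfVal_eq a fun k => ha _, cfVal_eq b fun k => hb _, h 0 (by omega)]
      have := one_le_cfVal (shiftSeq b) fun i => hb _
      gcongr

theorem one_div_le_one_div_add {x y δ : ℝ} (hδ : 0 ≤ δ) (hx : 1 ≤ x) (hy : 1 ≤ y)
    (h : y ≤ x + δ) : 1 / x ≤ 1 / y + δ := by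
  rw [div_add' _ _ _ (by linarith), div_le_div_iff₀ (by linarith) (by linarith)]
  nlinarith [mul_nonneg hδ (by nlinarith : 0 ≤ x * y - 1)]

/-! ### One-sided views of a bi-infinite sequence -/

/-- The right half of `A`, starting at position `i`. -/
def rightSeq (A : ℤ → ℕ) (i : ℤ) : ℕ → ℕ := fun n => A (i + n)

/-- The left half of `A`, read leftwards from position `i - 1`. -/
def leftSeq (A : ℤ → ℕ) (i : ℤ) : ℕ → ℕ := fun n => A (i - 1 - n)

/-- The reflection of a bi-infinite sequence. -/
def reflect (A : ℤ → ℕ) : ℤ → ℕ := fun n => A (-n)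

/-- The word `w` is a prefix of the sequence `a`. -/
def HasPrefix : List ℕ → (ℕ → ℕ) → Prop
  | [], _ => True
  | d :: w, a => a 0 = d ∧ HasPrefix w (shiftSeq a)

/-- The words `p.1` (read leftwards) and `p.2` (read rightwards) occur in `A` on the two sides
of position `i`. -/
def HasView (A : ℤ → ℕ) (i : ℤ) (p : List ℕ × List ℕ) : Prop :=
  HasPrefix p.1 (leftSeq A i) ∧ HasPrefix p.2 (rightSeq A i)

theorem shiftSeq_rightSeq (A : ℤ → ℕ) (i : ℤ) :
    shiftSeq (rightSeq A i) = rightSeq A (i + 1) := by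
  funext n
  simp only [shiftSeq, rightSeq]
  congr 1
  push_cast
  ring

theorem shiftSeq_leftSeq (A : ℤ → ℕ) (i : ℤ) :
    shiftSeq (leftSeq A i) = leftSeq A (i - 1) := by
  funext n
  simp only [shiftSeq, leftSeq]
  congr 1
  push_cast
  ring

theorem rightSeq_reflect (A : ℤ → ℕ) (i : ℤ) :
    rightSeq (reflect A) i = leftSeq A (1 - i) := by
  funext n
  simp only [reflect, rightSeq, leftSeq]
  congr 1
  ring

theorem leftSeq_reflect (A : ℤ → ℕ) (i : ℤ) :
    leftSeq (reflect A) i = rightSeq A (1 - i) := by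
  funext n
  simp only [reflect, rightSeq, leftSeq]
  congr 1
  ring

theorem HasPrefix.apply_eq : ∀ {w : List ℕ} {a : ℕ → ℕ}, HasPrefix w a →
    ∀ n < w.length, a n = w.getD n 0
  | [], _, _, n, hn => by simp at hn
  | d :: w, a, h, 0, _ => by simpa using h.1
  | d :: w, a, h, n + 1, hn => by
      exact HasPrefix.apply_eq h.2 n (by simpa using hn)

theorem hasPrefix_map_range (a : ℕ → ℕ) (k : ℕ) : HasPrefix ((List.range k).map a) a := by
  induction k generalizing a with
  | zero => trivial
  | succ k ih =>
      rw [List.range_succ_eq_map, List.map_cons, List.map_map]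
      exact ⟨rfl, ih (shiftSeq a)⟩

theorem HasPrefix.append : ∀ {w : List ℕ} {a : ℕ → ℕ}, HasPrefix w a →
    HasPrefix (w ++ [a w.length]) a
  | [], _, _ => ⟨rfl, trivial⟩
  | _ :: _, _, h => ⟨h.1, HasPrefix.append h.2⟩

theorem HasPrefix.of_isPrefixOf : ∀ {v w : List ℕ} {a : ℕ → ℕ}, v.isPrefixOf w = true →
    HasPrefix w a → HasPrefix v a
  | [], _, _, _, _ => trivial
  | _ :: _, [], _, h, _ => by simp at h
  | c :: v, d :: w, a, h, hw => by
      simp only [List.isPrefixOf, Bool.and_eq_true, beq_iff_eq] at h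
      exact ⟨h.1 ▸ hw.1, HasPrefix.of_isPrefixOf h.2 hw.2⟩

theorem HasView.moveRight {A : ℤ → ℕ} {i : ℤ} {l r : List ℕ} {d : ℕ}
    (h : HasView A i (l, d :: r)) : HasView A (i + 1) (d :: l, r) := by
  obtain ⟨h1, h2, h3⟩ := h
  refine ⟨⟨?_, ?_⟩, ?_⟩
  · simpa [leftSeq, rightSeq] using h2
  · rw [shiftSeq_leftSeq, add_sub_cancel_right]; exact h1
  · rwa [shiftSeq_rightSeq] at h3

theorem HasView.moveLeft {A : ℤ → ℕ} {i : ℤ} {l r : List ℕ} {d : ℕ}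
    (h : HasView A i (d :: l, r)) : HasView A (i - 1) (l, d :: r) := by
  obtain ⟨⟨h1, h2⟩, h3⟩ := h
  refine ⟨?_, ?_, ?_⟩
  · rwa [shiftSeq_leftSeq] at h2
  · simpa [leftSeq, rightSeq] using h1
  · rw [shiftSeq_rightSeq, sub_add_cancel]; exact h3

/-- Exchange the two sides of a view, keeping the digit at the centre. -/
def mirror (p : List ℕ × List ℕ) : List ℕ × List ℕ := (p.2.tail, p.2.headD 0 :: p.1)

theorem HasView.of_mirror {A : ℤ → ℕ} {i : ℤ} {l r : List ℕ} {d : ℕ}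
    (h : HasView A i (mirror (l, d :: r))) : HasView (reflect A) (-i) (l, d :: r) := by
  obtain ⟨h1, h2, h3⟩ := h
  refine ⟨?_, ?_, ?_⟩
  · rw [leftSeq_reflect, sub_neg_eq_add, add_comm]
    rwa [shiftSeq_rightSeq] at h3
  · simpa [rightSeq, reflect] using h2
  · rw [shiftSeq_rightSeq, rightSeq_reflect, show 1 - (-i + 1) = i by ring]
    exact h1

theorem lam_eq {A : ℤ → ℕ} (hA : ∀ n, 0 < A n) (i : ℤ) :
    lam A i = cfVal (rightSeq A i) + 1 / cfVal (leftSeq A i) := by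
  rw [← cf0_eq (leftSeq A i) fun _ => hA _]
  rfl

theorem lam_eq_digit_add {A : ℤ → ℕ} (hA : ∀ n, 0 < A n) (i : ℤ) :
    lam A i = A i + 1 / cfVal (rightSeq A (i + 1)) + 1 / cfVal (leftSeq A i) := by
  rw [lam_eq hA, cfVal_eq (rightSeq A i) fun _ => hA _, shiftSeq_rightSeq]
  simp [rightSeq]

theorem lam_reflect {A : ℤ → ℕ} (hA : ∀ n, 0 < A n) (i : ℤ) :
    lam (reflect A) (-i) = lam A i := by
  rw [lam_eq_digit_add hA, lam_eq_digit_add (A := reflect A) fun _ => hA _, rightSeq_reflect,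
    leftSeq_reflect, reflect, neg_neg, add_right_comm, sub_neg_eq_add, add_comm 1 i,
    show 1 - (-i + 1) = i by ring]

/-! ### Rational bounds from finite words -/

/-- Lower and upper bounds, as fractions, for the continued fractions that begin with a given
word and continue with digits `1` and `2`. -/
def cfBounds : List ℕ → (ℕ × ℕ) × (ℕ × ℕ)
  | [] => ((15, 11), (11, 4))
  | d :: w =>
    match cfBounds w with
    | ((p, q), (r, s)) => ((d * r + s, r), (d * p + q, p))

theorem cfVal_bounds_of_one_two {a : ℕ → ℕ} (ha : ∀ n, 0 < a n)
    (h : ∀ n < 4, a n = 1 ∨ a n = 2) : 15 / 11 ≤ cfVal a ∧ cfVal a ≤ 11 / 4 := by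
  have step : ∀ b : ℕ → ℕ, (∀ n, 0 < b n) → (b 0 = 1 ∨ b 0 = 2) → ∀ x y : ℝ, 0 < x →
      x ≤ cfVal (shiftSeq b) → cfVal (shiftSeq b) ≤ y →
      1 + 1 / y ≤ cfVal b ∧ cfVal b ≤ 2 + 1 / x := by
    intro b hb h0 x y hx hxb hby
    have h1 : 1 / cfVal (shiftSeq b) ≤ 1 / x := one_div_le_one_div_of_le hx hxb
    have h2 : 1 / y ≤ 1 / cfVal (shiftSeq b) := one_div_le_one_div_of_le (hx.trans_le hxb) hby
    rw [cfVal_eq b fun _ => hb _]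
    rcases h0 with h0 | h0 <;> rw [h0] <;> constructor <;> push_cast <;> linarith
  have h3 := cfVal_mem_Icc (shiftSeq (shiftSeq (shiftSeq a))) fun _ => ha _
  have h3' : (1 : ℝ) ≤ cfVal (shiftSeq (shiftSeq (shiftSeq a))) := one_le_cfVal _ fun _ => ha _
  have h3u : cfVal (shiftSeq (shiftSeq (shiftSeq a))) ≤ 3 := by
    refine h3.2.trans ?_
    have : (shiftSeq (shiftSeq (shiftSeq a)) 0 : ℝ) ≤ 2 := by
      have h3 : shiftSeq (shiftSeq (shiftSeq a)) 0 ≤ 2 := by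
        have := h 3 (by norm_num)
        change a 3 ≤ 2
        omega
      exact_mod_cast h3
    linarith
  obtain ⟨l2, u2⟩ := step (shiftSeq (shiftSeq a)) (fun _ => ha _) (h 2 (by norm_num)) _ _
    one_pos h3' h3u
  obtain ⟨l1, u1⟩ := step (shiftSeq a) (fun _ => ha _) (h 1 (by norm_num)) _ _
    (by norm_num) l2 u2
  obtain ⟨l0, u0⟩ := step a (fun _ => ha _) (h 0 (by norm_num)) _ _ (by norm_num) l1 u1
  norm_num at l0 u0
  exact ⟨l0, by linarith⟩

theorem cfBounds_spec : ∀ (w : List ℕ) (a : ℕ → ℕ), (∀ n, 0 < a n) → HasPrefix w a →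
    (∀ n < w.length + 4, a n = 1 ∨ a n = 2) →
    (0 < (cfBounds w).1.1 ∧ 0 < (cfBounds w).1.2 ∧ 0 < (cfBounds w).2.1 ∧
      0 < (cfBounds w).2.2) ∧
    ((cfBounds w).1.1 : ℝ) ≤ cfVal a * (cfBounds w).1.2 ∧
    cfVal a * (cfBounds w).2.2 ≤ (cfBounds w).2.1
  | [], a, ha, _, h12 => by
      obtain ⟨h1, h2⟩ := cfVal_bounds_of_one_two ha h12
      simp only [cfBounds]
      refine ⟨by norm_num, ?_, ?_⟩ <;> push_cast <;> linarith
  | d :: w, a, ha, h, h12 => by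
      obtain ⟨⟨hp, hq, hr, hs⟩, h1, h2⟩ := cfBounds_spec w (shiftSeq a) (fun _ => ha _) h.2
        fun n hn => h12 (n + 1) (by simp only [List.length_cons]; omega)
      have hv := one_le_cfVal (shiftSeq a) fun _ => ha _
      rw [cfVal_eq a fun _ => ha _, h.1]
      simp only [cfBounds]
      generalize (cfBounds w).1.1 = p at *
      generalize (cfBounds w).1.2 = q at *
      generalize (cfBounds w).2.1 = r at *
      generalize (cfBounds w).2.2 = s at *
      generalize cfVal (shiftSeq a) = x at *
      have hx : 0 < x := by linarith
      refine ⟨⟨by positivity, hr, by positivity, hp⟩, ?_, ?_⟩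
      · have : (s : ℝ) ≤ 1 / x * r := by
          rw [one_div, inv_mul_eq_div, le_div_iff₀ hx]; linarith
        push_cast
        linarith
      · have : 1 / x * p ≤ (q : ℝ) := by
          rw [one_div, inv_mul_eq_div, div_le_iff₀ hx]; linarith
        push_cast
        linarith

/-- A certificate that `P / 10 ^ 11` is a lower bound at the centre of the view `(l, r)`. -/
def lowerCheck (P : ℕ) (l r : List ℕ) : Bool :=
  match (cfBounds r).1, (cfBounds l).2 with
  | (a, b), (c, e) => Nat.ble (P * b * c) ((a * c + e * b) * 10 ^ 11)

/-- A certificate that `P / 10 ^ 11` is an upper bound at the centre of the view `(l, r)`. -/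
def upperCheck (P : ℕ) (l r : List ℕ) : Bool :=
  match (cfBounds r).2, (cfBounds l).1 with
  | (a, b), (c, e) => Nat.ble ((a * c + e * b) * 10 ^ 11) (P * b * c)

theorem le_of_lowerCheck {P : ℕ} {l r : List ℕ} {f g : ℕ → ℕ} (hf : ∀ n, 0 < f n)
    (hg : ∀ n, 0 < g n) (hl : HasPrefix l g) (hr : HasPrefix r f)
    (hl12 : ∀ n < l.length + 4, g n = 1 ∨ g n = 2)
    (hr12 : ∀ n < r.length + 4, f n = 1 ∨ f n = 2) (h : lowerCheck P l r = true) :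
    (P : ℝ) / 10 ^ 11 ≤ cfVal f + 1 / cfVal g := by
  obtain ⟨⟨-, hb, -, -⟩, h1, -⟩ := cfBounds_spec r f hf hr hr12
  obtain ⟨⟨-, -, hc, -⟩, -, h2⟩ := cfBounds_spec l g hg hl hl12
  have hx := one_le_cfVal g hg
  simp only [lowerCheck] at h
  generalize (cfBounds r).1.1 = a at *
  generalize (cfBounds r).1.2 = b at *
  generalize (cfBounds l).2.1 = c at *
  generalize (cfBounds l).2.2 = e at *
  have h' : (P * b * c : ℝ) ≤ (a * c + e * b) * 10 ^ 11 := by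
    exact_mod_cast Nat.le_of_ble_eq_true h
  have hb' : (0 : ℝ) < b := by exact_mod_cast hb
  have hc' : (0 : ℝ) < c := by exact_mod_cast hc
  have e1 : (a : ℝ) / b ≤ cfVal f := by rwa [div_le_iff₀ hb']
  have e2 : (e : ℝ) / c ≤ 1 / cfVal g := by
    rw [div_le_div_iff₀ hc' (by linarith)]; linarith
  have e3 : (P : ℝ) / 10 ^ 11 ≤ a / b + e / c := by
    rw [div_add_div _ _ hb'.ne' hc'.ne', div_le_div_iff₀ (by positivity) (by positivity)]
    linarith
  linarith

theorem le_of_upperCheck {P : ℕ} {l r : List ℕ} {f g : ℕ → ℕ} (hf : ∀ n, 0 < f n)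
    (hg : ∀ n, 0 < g n) (hl : HasPrefix l g) (hr : HasPrefix r f)
    (hl12 : ∀ n < l.length + 4, g n = 1 ∨ g n = 2)
    (hr12 : ∀ n < r.length + 4, f n = 1 ∨ f n = 2) (h : upperCheck P l r = true) :
    cfVal f + 1 / cfVal g ≤ (P : ℝ) / 10 ^ 11 := by
  obtain ⟨⟨-, -, -, hb⟩, -, h1⟩ := cfBounds_spec r f hf hr hr12
  obtain ⟨⟨hc, -, -, -⟩, h2, -⟩ := cfBounds_spec l g hg hl hl12
  have hx := one_le_cfVal g hg
  simp only [upperCheck] at h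
  generalize (cfBounds r).2.1 = a at *
  generalize (cfBounds r).2.2 = b at *
  generalize (cfBounds l).1.1 = c at *
  generalize (cfBounds l).1.2 = e at *
  have h' : ((a * c + e * b) * 10 ^ 11 : ℝ) ≤ P * b * c := by
    exact_mod_cast Nat.le_of_ble_eq_true h
  have hb' : (0 : ℝ) < b := by exact_mod_cast hb
  have hc' : (0 : ℝ) < c := by exact_mod_cast hc
  have e1 : cfVal f ≤ (a : ℝ) / b := by rwa [le_div_iff₀ hb']
  have e2 : 1 / cfVal g ≤ (e : ℝ) / c := by
    rw [div_le_div_iff₀ (by linarith) hc']; linarith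
  have e3 : (a : ℝ) / b + e / c ≤ P / 10 ^ 11 := by
    rw [div_add_div _ _ hb'.ne' hc'.ne', div_le_div_iff₀ (by positivity) (by positivity)]
    linarith
  linarith

/-! ### Searching the tree of local views -/

/-- All digits in `[a, b]` are `1` or `2`, and all values `λ_j` there are below `κ`. -/
def GoodOn (κ : ℝ) (A : ℤ → ℕ) (a b : ℤ) : Prop :=
  ∀ j, a ≤ j → j ≤ b → (A j = 1 ∨ A j = 2) ∧ lam A j < κ

theorem GoodOn.mono {κ : ℝ} {A : ℤ → ℕ} {a b a' b' : ℤ} (h : GoodOn κ A a b) (ha : a ≤ a')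
    (hb : b' ≤ b) : GoodOn κ A a' b' :=
  fun j h1 h2 => h j (ha.trans h1) (h2.trans hb)

theorem GoodOn.reflect {κ : ℝ} {A : ℤ → ℕ} {a b : ℤ} (hA : ∀ n, 0 < A n)
    (h : GoodOn κ A (-b) (-a)) : GoodOn κ (reflect A) a b := fun j h1 h2 => by
  have := h (-j) (by omega) (by omega)
  rwa [← lam_reflect hA, neg_neg] at this

/-- Numerator over `10 ^ 11` of an upper bound of `CInf`. -/
def upperNum : ℕ := 311812017833

/-- Numerator over `10 ^ 11` of a lower bound of `cInf`. -/
def lowerNum : ℕ := 311812017814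

/-- Some `λ` centred at a digit of `r` is certified to be at least `CInf`. -/
def scanRight : List ℕ → List ℕ → Bool
  | _, [] => false
  | l, d :: r => (Nat.beq d 2 && lowerCheck upperNum l (d :: r)) || scanRight (d :: l) r

/-- Some `λ` centred at a digit of `l` is certified to be at least `CInf`. -/
def scanLeft : List ℕ → List ℕ → Bool
  | [], _ => false
  | d :: l, r => (Nat.beq d 2 && lowerCheck upperNum l (d :: r)) || scanLeft l (d :: r)

/-- The view `(l, r)` extends one of the views in `goals`, or it is excluded by a certified
inequality; with `low` the view is also excluded if its central `λ` is at most `cInf`. -/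
def isLeaf (goals : List (List ℕ × List ℕ)) (low : Bool) (l r : List ℕ) : Bool :=
  goals.any (fun g => g.1.isPrefixOf l && g.2.isPrefixOf r) ||
    ((low && upperCheck lowerNum l r) || (scanLeft l r || scanRight l r))

/-- All extensions of the view `(l, r)` by digits `1` and `2` end in leaves. -/
def search (goals : List (List ℕ × List ℕ)) (low : Bool) : ℕ → List ℕ → List ℕ → Bool
  | 0, l, r => isLeaf goals low l r
  | k + 1, l, r => isLeaf goals low l r ||
      bif Nat.blt l.length r.length then
        search goals low k (l ++ [1]) r && search goals low k (l ++ [2]) r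
      else search goals low k l (r ++ [1]) && search goals low k l (r ++ [2])

section Search

variable {κ : ℝ} {A : ℤ → ℕ}

theorem GoodOn.digits_left {i a b : ℤ} {k : ℕ} (h : GoodOn κ A a b) (ha : a ≤ i - k)
    (hb : i ≤ b + 1) : ∀ n < k, leftSeq A i n = 1 ∨ leftSeq A i n = 2 :=
  fun n hn => (h (i - 1 - n) (by omega) (by omega)).1

theorem GoodOn.digits_right {i a b : ℤ} {k : ℕ} (h : GoodOn κ A a b) (ha : a ≤ i)
    (hb : i + k ≤ b + 1) : ∀ n < k, rightSeq A i n = 1 ∨ rightSeq A i n = 2 :=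
  fun n hn => (h (i + n) (by omega) (by omega)).1

theorem lowerCheck_eq_false (hA : ∀ n, 0 < A n) (hκ : κ ≤ (upperNum : ℝ) / 10 ^ 11) {i : ℤ}
    {l r : List ℕ} (hG : GoodOn κ A (i - l.length - 4) (i + r.length + 4))
    (hv : HasView A i (l, r)) : lowerCheck upperNum l r = false := by
  by_contra h
  rw [Bool.not_eq_false] at h
  have h1 := le_of_lowerCheck (f := rightSeq A i) (g := leftSeq A i) (fun _ => hA _)
    (fun _ => hA _) hv.1 hv.2 (hG.digits_left (by push_cast; omega) (by omega))
    (hG.digits_right (by omega) (by push_cast; omega)) h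
  have h2 := (hG i (by omega) (by omega)).2
  rw [lam_eq hA] at h2
  linarith

theorem scanRight_eq_false (hA : ∀ n, 0 < A n) (hκ : κ ≤ (upperNum : ℝ) / 10 ^ 11) :
    ∀ (r l : List ℕ) (i : ℤ), GoodOn κ A (i - l.length - 4) (i + r.length + 4) →
      HasView A i (l, r) → scanRight l r = false
  | [], _, _, _, _ => rfl
  | d :: r, l, i, hG, hv => by
      rw [scanRight, lowerCheck_eq_false hA hκ hG hv, Bool.and_false, Bool.false_or]
      refine scanRight_eq_false hA hκ r (d :: l) (i + 1) (hG.mono ?_ ?_) hv.moveRight <;>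
        simp only [List.length_cons] <;> push_cast <;> omega

theorem scanLeft_eq_false (hA : ∀ n, 0 < A n) (hκ : κ ≤ (upperNum : ℝ) / 10 ^ 11) :
    ∀ (l r : List ℕ) (i : ℤ), GoodOn κ A (i - l.length - 4) (i + r.length + 4) →
      HasView A i (l, r) → scanLeft l r = false
  | [], _, _, _, _ => rfl
  | d :: l, r, i, hG, hv => by
      have hG' : GoodOn κ A (i - 1 - l.length - 4) (i - 1 + (d :: r).length + 4) := by
        refine hG.mono ?_ ?_ <;> simp only [List.length_cons] <;> push_cast <;> omega
      rw [scanLeft, lowerCheck_eq_false hA hκ hG' hv.moveLeft, Bool.and_false, Bool.false_or]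
      exact scanLeft_eq_false hA hκ l (d :: r) (i - 1) hG' hv.moveLeft

theorem exists_goal_of_isLeaf (hA : ∀ n, 0 < A n) (hκ : κ ≤ (upperNum : ℝ) / 10 ^ 11)
    {goals : List (List ℕ × List ℕ)} {low : Bool} {l r : List ℕ} {i : ℤ}
    (hG : GoodOn κ A (i - l.length - 4) (i + r.length + 4)) (hv : HasView A i (l, r))
    (hlow : low = true → (lowerNum : ℝ) / 10 ^ 11 < lam A i)
    (h : isLeaf goals low l r = true) : ∃ g ∈ goals, HasView A i g := by
  rw [isLeaf, scanLeft_eq_false hA hκ l r i hG hv, scanRight_eq_false hA hκ r l i hG hv,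
    Bool.or_false, Bool.or_false, Bool.or_eq_true, Bool.and_eq_true, List.any_eq_true] at h
  rcases h with ⟨g, hg, h⟩ | ⟨h1, h2⟩
  · rw [Bool.and_eq_true] at h
    exact ⟨g, hg, HasPrefix.of_isPrefixOf h.1 hv.1, HasPrefix.of_isPrefixOf h.2 hv.2⟩
  · have h3 := le_of_upperCheck (f := rightSeq A i) (g := leftSeq A i) (fun _ => hA _)
      (fun _ => hA _) hv.1 hv.2 (hG.digits_left (by push_cast; omega) (by omega))
      (hG.digits_right (by omega) (by push_cast; omega)) h2
    have h4 := hlow h1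
    rw [lam_eq hA] at h4
    linarith

theorem exists_goal_of_search (hA : ∀ n, 0 < A n) (hκ : κ ≤ (upperNum : ℝ) / 10 ^ 11)
    {goals : List (List ℕ × List ℕ)} {low : Bool} {i : ℤ}
    (hlow : low = true → (lowerNum : ℝ) / 10 ^ 11 < lam A i) :
    ∀ (k : ℕ) (l r : List ℕ), GoodOn κ A (i - (l.length + k) - 4) (i + (r.length + k) + 4) →
      HasView A i (l, r) → search goals low k l r = true → ∃ g ∈ goals, HasView A i g
  | 0, l, r, hG, hv, h =>
      exists_goal_of_isLeaf hA hκ (by simpa using hG) hv hlow h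
  | k + 1, l, r, hG, hv, h => by
      rw [search, Bool.or_eq_true] at h
      rcases h with h | h
      · exact exists_goal_of_isLeaf hA hκ (hG.mono (by push_cast; omega) (by push_cast; omega))
          hv hlow h
      · have hl : HasView A i (l ++ [leftSeq A i l.length], r) := ⟨hv.1.append, hv.2⟩
        have hr : HasView A i (l, r ++ [rightSeq A i r.length]) := ⟨hv.1, hv.2.append⟩
        have dl := hG.digits_left (i := i) (k := l.length + 1) (by push_cast; omega) (by omega)
          l.length (by omega)
        have dr := hG.digits_right (i := i) (k := r.length + 1) (by omega) (by push_cast; omega)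
          r.length (by omega)
        cases hb : Nat.blt l.length r.length <;> rw [hb] at h
        · rw [cond_false, Bool.and_eq_true] at h
          refine exists_goal_of_search hA hκ hlow k l _ (hG.mono ?_ ?_) hr ?_
          · push_cast; omega
          · simp only [List.length_append, List.length_singleton]; push_cast; omega
          · rcases dr with dr | dr <;> rw [dr]
            exacts [h.1, h.2]
        · rw [cond_true, Bool.and_eq_true] at h
          refine exists_goal_of_search hA hκ hlow k _ r (hG.mono ?_ ?_) hl ?_
          · simp only [List.length_append, List.length_singleton]; push_cast; omega
          · push_cast; omega
          · rcases dl with dl | dl <;> rw [dl]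
            exacts [h.1, h.2]

end Search

/-! ### The three families of local views -/

/-- The view `1 2_2 1_2 2_4 1 2_2 1_2 2_3 | 2 1 2_2 1_2 2_4 1 2_2 1_2 2`, whose left side is
periodic. -/
def repView : List ℕ × List ℕ :=
  ([2,2,2,1,1,2,2,1,2,2,2,2,1,1,2,2,1], [2,1,2,2,1,1,2,2,2,2,1,2,2,1,1,2])

/-- The view `1_4 2_4 1 2_2 1_2 2_3 | 2 1 2_2 1_2 2_4 1 2_2 1_2 2_3`, at which `λ` is at least
`CInf`. -/
def maxView : List ℕ × List ℕ :=
  ([2,2,2,1,1,2,2,1,2,2,2,2,1,1,1,1], [2,1,2,2,1,1,2,2,2,2,1,2,2,1,1,2,2,2])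

theorem search_from_centre :
    search [repView, mirror repView, maxView, mirror maxView] true 35 [] [2] = true := by
  decide +kernel

theorem search_from_shifted_repView :
    search [repView, maxView] false 10 [2,2,2,1,1,2,2,1]
      [2,1,2,2,1,1,2,2,2,2,1,2,2,1,1,2,2,2,2,1,2,2,1,1,2] = true := by
  decide +kernel

/-! ### Bounds for `cInf` and `CInf` -/

theorem getD_one_or_two {w : List ℕ} (hw : ∀ d ∈ w, d = 1 ∨ d = 2) (n : ℕ) :
    w.getD n 1 = 1 ∨ w.getD n 1 = 2 := by
  rcases lt_or_ge n w.length with h | h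
  · rw [List.getD_eq_getElem _ _ h]
    exact hw _ (List.getElem_mem h)
  · exact Or.inl (List.getD_eq_default _ _ h)

theorem perSeq_one_or_two {w : List ℕ} (hw : ∀ d ∈ w, d = 1 ∨ d = 2) (n : ℕ) :
    perSeq w n = 1 ∨ perSeq w n = 2 := getD_one_or_two hw _

theorem prePer_one_or_two {p w : List ℕ} (hp : ∀ d ∈ p, d = 1 ∨ d = 2)
    (hw : ∀ d ∈ w, d = 1 ∨ d = 2) (n : ℕ) : prePer p w n = 1 ∨ prePer p w n = 2 := by
  rw [prePer, catSeq]
  split_ifs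
  · exact getD_one_or_two hp n
  · exact perSeq_one_or_two hw _

theorem perSeq_add_length (w : List ℕ) (n : ℕ) : perSeq w (n + w.length) = perSeq w n := by
  rw [perSeq, perSeq, Nat.add_mod_right]

theorem prePer_add_length {p w : List ℕ} {n : ℕ} (hn : p.length ≤ n) :
    prePer p w (n + w.length) = prePer p w n := by
  rw [prePer, catSeq, catSeq, if_neg (by omega), if_neg (by omega), Nat.sub_add_comm hn,
    perSeq_add_length]

theorem pos_of_one_or_two {a : ℕ → ℕ} (h : ∀ n, a n = 1 ∨ a n = 2) (n : ℕ) : 0 < a n := by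
  rcases h n with h | h <;> omega

/-- The right half of the sequence defining `CInf`. -/
def CRight : ℕ → ℕ :=
  prePer [2,1,2,2,1,1,2,2,2,2,1,2,2,1,1,2,2,2,2,1,2,2,1,1,2,2,1,2,2,2,2,1,1] [2,2,2,1,1,1]

/-- The left half of the sequence defining `CInf`. -/
def CLeft : ℕ → ℕ := prePer [2,2,2,1,1,2,2,1,2,2,2,2,1] [1,1,1,2,2,2]

/-- The right half of the sequence defining `cInf`. -/
def cRight : ℕ → ℕ := perSeq [2,2,2,2,1,1,2,2,1]

/-- The left half of the sequence defining `cInf`. -/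
def cLeft : ℕ → ℕ := perSeq [1,2,2,1,1,2,2,2,2]

theorem CRight_one_or_two : ∀ n, CRight n = 1 ∨ CRight n = 2 :=
  prePer_one_or_two (by decide) (by decide)

theorem CLeft_one_or_two : ∀ n, CLeft n = 1 ∨ CLeft n = 2 :=
  prePer_one_or_two (by decide) (by decide)

theorem cRight_one_or_two : ∀ n, cRight n = 1 ∨ cRight n = 2 := perSeq_one_or_two (by decide)

theorem cLeft_one_or_two : ∀ n, cLeft n = 1 ∨ cLeft n = 2 := perSeq_one_or_two (by decide)

theorem CInf_eq : CInf = cfVal CRight + 1 / cfVal CLeft := by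
  rw [← cf0_eq CLeft (pos_of_one_or_two CLeft_one_or_two)]
  rfl

theorem cInf_eq : cInf = cfVal cRight + 1 / cfVal cLeft := by
  rw [← cf0_eq cLeft (pos_of_one_or_two cLeft_one_or_two)]
  rfl

theorem CInf_le : CInf ≤ (upperNum : ℝ) / 10 ^ 11 := by
  rw [CInf_eq]
  exact le_of_upperCheck (pos_of_one_or_two CRight_one_or_two)
    (pos_of_one_or_two CLeft_one_or_two) (hasPrefix_map_range CLeft 20)
    (hasPrefix_map_range CRight 20) (fun n _ => CLeft_one_or_two n)
    (fun n _ => CRight_one_or_two n) (by decide +kernel)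

theorem le_cInf : (lowerNum : ℝ) / 10 ^ 11 ≤ cInf := by
  rw [cInf_eq]
  exact le_of_lowerCheck (pos_of_one_or_two cRight_one_or_two)
    (pos_of_one_or_two cLeft_one_or_two) (hasPrefix_map_range cLeft 20)
    (hasPrefix_map_range cRight 20) (fun n _ => cLeft_one_or_two n)
    (fun n _ => cRight_one_or_two n) (by decide +kernel)

/-! ### Extremality of the tails of `CInf` -/

/-- The digit of `e` at place `n` is such that replacing it by the other digit decreases
(for `s = 0`) or increases (for `s = 1`) the value of the continued fraction. -/
def isCritical (e : ℕ → ℕ) (s n : ℕ) : Bool :=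
  Nat.beq (e n) (bif Nat.beq ((n + s) % 2) 0 then 2 else 1)

/-- The list `e (n - 1), ..., e 0` followed by `l`. -/
def pushDigits (e : ℕ → ℕ) : ℕ → List ℕ → List ℕ
  | 0, l => l
  | n + 1, l => e n :: pushDigits e n l

/-- If `d` is to the left of the word `l`, its replacement by the other digit is excluded. -/
def flipCheck (critical : Bool) (l : List ℕ) (d : ℕ) : Bool :=
  !critical || (scanLeft l [3 - d] || scanRight l [3 - d])

theorem length_pushDigits (e : ℕ → ℕ) (l : List ℕ) (n : ℕ) :
    (pushDigits e n l).length = n + l.length := by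
  induction n with
  | zero => simp [pushDigits]
  | succ n ih => rw [pushDigits, List.length_cons, ih]; omega

theorem HasPrefix.pushDigits {A : ℤ → ℕ} {i : ℤ} {l : List ℕ} {e : ℕ → ℕ}
    (hl : HasPrefix l (leftSeq A i)) : ∀ n : ℕ, (∀ m < n, A (i + m) = e m) →
      HasPrefix (pushDigits e n l) (leftSeq A (i + n))
  | 0, _ => by simpa [_root_.pushDigits] using hl
  | n + 1, h => by
      refine ⟨?_, ?_⟩
      · rw [← h n (by omega), leftSeq]
        congr 1
        push_cast
        ring
      · rw [shiftSeq_leftSeq]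
        convert HasPrefix.pushDigits hl n fun m hm => h m (by omega) using 2
        push_cast
        ring

theorem not_critical_of_flipCheck {κ : ℝ} {A : ℤ → ℕ} (hA : ∀ n, 0 < A n)
    (hκ : κ ≤ (upperNum : ℝ) / 10 ^ 11) {j : ℤ} {l : List ℕ} {critical : Bool} {d : ℕ}
    (hG : GoodOn κ A (j - l.length - 4) (j + 5)) (hl : HasPrefix l (leftSeq A j))
    (hd : d = 1 ∨ d = 2) (hne : A j ≠ d) (h : flipCheck critical l d = true) :
    critical = false := by
  have hj := (hG j (by omega) (by omega)).1
  have hG' : GoodOn κ A (j - l.length - 4) (j + [3 - d].length + 4) :=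
    hG.mono le_rfl (by simp; omega)
  have hv : HasView A j (l, [3 - d]) := ⟨hl, by simp only [rightSeq]; simp; omega, trivial⟩
  rw [flipCheck, scanLeft_eq_false hA hκ _ _ j hG' hv, scanRight_eq_false hA hκ _ _ j hG' hv,
    Bool.or_false, Bool.or_false, Bool.not_eq_true'] at h
  exact h

theorem not_critical_of_first_difference {κ : ℝ} {A : ℤ → ℕ} (hA : ∀ n, 0 < A n)
    (hκ : κ ≤ (upperNum : ℝ) / 10 ^ 11) {i : ℤ} {l : List ℕ} {e : ℕ → ℕ} {s k n₀ M : ℕ}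
    (he : ∀ n, e n = 1 ∨ e n = 2) (hper : ∀ n, n₀ ≤ n → e (n + 6) = e n)
    (hstart : ∀ n < n₀ + 6, k ≤ n → flipCheck (isCritical e s n) (pushDigits e n l) (e n) = true)
    (hcycle : ∀ t < 6, flipCheck (isCritical e s (n₀ + t + 6))
      (pushDigits (fun m => e (n₀ + t + m)) 6 []) (e (n₀ + t + 6)) = true)
    (hG : GoodOn κ A (i - l.length - 4) (i + M + 5)) (hl : HasPrefix l (leftSeq A i))
    (hk : ∀ n < k, A (i + n) = e n) {n : ℕ} (hn : n ≤ M) (heq : ∀ m < n, A (i + m) = e m)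
    (hne : A (i + n) ≠ e n) : isCritical e s n = false := by
  rcases lt_or_ge n (n₀ + 6) with h | h
  · refine not_critical_of_flipCheck hA hκ (hG.mono ?_ (by omega)) (hl.pushDigits n heq) (he n)
      hne (hstart n h ?_)
    · rw [length_pushDigits]; push_cast; omega
    · by_contra hlt
      exact hne (hk n (by omega))
  · have hper' : ∀ q m, n₀ ≤ m → e (m + 6 * q) = e m := by
      intro q
      induction q with
      | zero => simp
      | succ q ih =>
          intro m hm
          rw [show m + 6 * (q + 1) = m + 6 * q + 6 by ring, hper _ (by omega), ih m hm]
    obtain ⟨q, t, ht, rfl⟩ : ∃ q t, t < 6 ∧ n = n₀ + t + 6 + 6 * q :=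
      ⟨(n - n₀ - 6) / 6, (n - n₀ - 6) % 6, Nat.mod_lt _ (by norm_num), by omega⟩
    have hcrit : isCritical e s (n₀ + t + 6 + 6 * q) = isCritical e s (n₀ + t + 6) := by
      rw [isCritical, isCritical, hper' _ _ (by omega),
        show (n₀ + t + 6 + 6 * q + s) % 2 = (n₀ + t + 6 + s) % 2 by omega]
    rw [hcrit]
    rw [hper' _ _ (by omega)] at hne
    have hp : HasPrefix (pushDigits (fun m => e (n₀ + t + m)) 6 [])
        (leftSeq A (i + (n₀ + t + 6 * q : ℕ) + (6 : ℕ))) := by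
      refine HasPrefix.pushDigits (l := []) (i := i + (n₀ + t + 6 * q : ℕ)) trivial 6
        fun m hm => ?_
      rw [← hper' q _ (by omega), ← heq _ (by omega)]
      congr 1
      push_cast
      ring
    refine not_critical_of_flipCheck hA hκ (hG.mono ?_ (by omega)) ?_ (he _) hne (hcycle t ht)
    · rw [length_pushDigits]; push_cast; simp; omega
    · convert hp using 2
      push_cast
      ring

theorem cfVal_bound_of_flipChecks {κ : ℝ} {A : ℤ → ℕ} (hA : ∀ n, 0 < A n)
    (hκ : κ ≤ (upperNum : ℝ) / 10 ^ 11) {i : ℤ} {l : List ℕ} {e : ℕ → ℕ} {s k n₀ K : ℕ}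
    (he : ∀ n, e n = 1 ∨ e n = 2) (hper : ∀ n, n₀ ≤ n → e (n + 6) = e n)
    (hstart : ∀ n < n₀ + 6, k ≤ n → flipCheck (isCritical e s n) (pushDigits e n l) (e n) = true)
    (hcycle : ∀ t < 6, flipCheck (isCritical e s (n₀ + t + 6))
      (pushDigits (fun m => e (n₀ + t + m)) 6 []) (e (n₀ + t + 6)) = true)
    (hG : GoodOn κ A (i - l.length - 4) (i + (2 * K : ℕ) + 5)) (hl : HasPrefix l (leftSeq A i))
    (hk : ∀ n < k, A (i + n) = e n) :
    (s = 0 → cfVal e ≤ cfVal (rightSeq A i) + (1 / 4) ^ K) ∧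
    (s = 1 → cfVal (rightSeq A i) ≤ cfVal e + (1 / 4) ^ K) := by
  have hpow : (0 : ℝ) < (1 / 4) ^ K := by positivity
  have hpos := pos_of_one_or_two he
  by_cases hall : ∀ n ≤ 2 * K, A (i + n) = e n
  · have := abs_le.1 (abs_cfVal_sub_le K (rightSeq A i) e (fun _ => hA _) hpos hall)
    constructor <;> intro <;> linarith
  · push Not at hall
    classical
    obtain ⟨hn, hne⟩ := Nat.find_spec hall
    have heq : ∀ m < Nat.find hall, A (i + m) = e m := fun m hm => by
      have := Nat.find_min hall hm
      push Not at this
      exact this (by omega)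
    generalize Nat.find hall = n at *
    have hcrit := not_critical_of_first_difference hA hκ he hper hstart hcycle hG hl hk hn heq hne
    have hd := (hG (i + n) (by omega) (by omega)).1
    have hen := he n
    rw [isCritical] at hcrit
    have hb : e n ≠ bif Nat.beq ((n + s) % 2) 0 then 2 else 1 := by
      intro h
      rw [← h, Nat.beq_refl] at hcrit
      exact Bool.noConfusion hcrit
    rcases Nat.mod_two_eq_zero_or_one n with hp | hp
    · constructor <;> rintro rfl
      · rw [Nat.add_zero, hp] at hb
        have := cfVal_le_of_first_difference n e (rightSeq A i) hpos (fun _ => hA _)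
          (fun m hm => (heq m hm).symm) (by
            rw [if_pos hp, rightSeq]
            change e n ≠ 2 at hb
            omega)
        linarith
      · rw [show (n + 1) % 2 = 1 by omega] at hb
        have := cfVal_le_of_first_difference n (rightSeq A i) e (fun _ => hA _) hpos heq (by
            rw [if_pos hp, rightSeq]
            change e n ≠ 1 at hb
            omega)
        linarith
    · constructor <;> rintro rfl
      · rw [Nat.add_zero, hp] at hb
        have := cfVal_le_of_first_difference n e (rightSeq A i) hpos (fun _ => hA _)
          (fun m hm => (heq m hm).symm) (by
            rw [if_neg (by omega), rightSeq]
            change e n ≠ 1 at hb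
            omega)
        linarith
      · rw [show (n + 1) % 2 = 0 by omega] at hb
        have := cfVal_le_of_first_difference n (rightSeq A i) e (fun _ => hA _) hpos heq (by
            rw [if_neg (by omega), rightSeq]
            change e n ≠ 2 at hb
            omega)
        linarith

theorem CInf_le_of_maxView {κ : ℝ} {A : ℤ → ℕ} (hA : ∀ n, 0 < A n)
    (hκ : κ ≤ (upperNum : ℝ) / 10 ^ 11) {i : ℤ} {K : ℕ}
    (hG : GoodOn κ A (i - 2 * K - 30) (i + 2 * K + 30)) (hv : HasView A i maxView) :
    CInf ≤ lam A i + 2 * (1 / 4) ^ K := by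
  have hR := (cfVal_bound_of_flipChecks hA hκ (i := i) (l := maxView.1) (e := CRight) (s := 0)
    (k := 18) (n₀ := 33) (K := K) CRight_one_or_two (fun n hn => prePer_add_length hn)
    (by decide +kernel) (by decide +kernel)
    (hG.mono (by simp [maxView]; omega) (by push_cast; omega)) hv.1 (fun n hn => by
      have := hv.2.apply_eq n hn
      rw [rightSeq] at this
      rw [this]
      clear this
      revert n
      decide +kernel)).1 rfl
  have hG' : GoodOn κ (reflect A) (1 - i - maxView.2.length - 4) (1 - i + (2 * K : ℕ) + 5) :=
    (hG.mono (by push_cast; omega) (by simp [maxView]; omega)).reflect hA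
  have hL := (cfVal_bound_of_flipChecks (A := reflect A) (fun _ => hA _) hκ (i := 1 - i)
    (l := maxView.2) (e := CLeft) (s := 1) (k := 16) (n₀ := 13) (K := K) CLeft_one_or_two
    (fun n hn => prePer_add_length hn) (by decide +kernel) (by decide +kernel) hG'
    (by rw [leftSeq_reflect, sub_sub_cancel]; exact hv.2) (fun n hn => by
      have h1 := hv.1.apply_eq n hn
      have h2 := congrFun (rightSeq_reflect A (1 - i)) n
      rw [sub_sub_cancel, h1, rightSeq] at h2
      rw [h2]
      clear h1 h2
      revert n
      decide +kernel)).2 rfl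
  rw [rightSeq_reflect, sub_sub_cancel] at hL
  rw [lam_eq hA, CInf_eq]
  have h := one_div_le_one_div_add (by positivity)
    (one_le_cfVal CLeft (pos_of_one_or_two CLeft_one_or_two))
    (one_le_cfVal (leftSeq A i) fun _ => hA _) hL
  linarith

/-! ### Replication of views and eventual periodicity -/

theorem reflect_reflect (A : ℤ → ℕ) : reflect (reflect A) = A := by
  funext n
  simp [reflect]

theorem HasView.apply_right {A : ℤ → ℕ} {i : ℤ} {p : List ℕ × List ℕ} (h : HasView A i p)
    {t : ℕ} (ht : t < p.2.length) : A (i + t) = p.2.getD t 0 := h.2.apply_eq t ht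

theorem HasView.apply_left {A : ℤ → ℕ} {i : ℤ} {p : List ℕ × List ℕ} (h : HasView A i p)
    {t : ℕ} (ht : t < p.1.length) : A (i - 1 - t) = p.1.getD t 0 := h.1.apply_eq t ht

section Local

variable {κ : ℝ} {A : ℤ → ℕ} {i : ℤ} {K : ℕ}

theorem not_hasView_maxView (hA : ∀ n, 0 < A n) (hκ : κ + 2 * (1 / 4) ^ K ≤ CInf)
    (hG : GoodOn κ A (i - 2 * K - 30) (i + 2 * K + 30)) : ¬ HasView A i maxView := fun hv => by
  have hpow : (0 : ℝ) < (1 / 4) ^ K := by positivity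
  have h1 := CInf_le_of_maxView hA (by linarith [CInf_le]) hG hv
  have h2 := (hG i (by omega) (by omega)).2
  linarith

theorem hasView_repView_or_mirror (hA : ∀ n, 0 < A n) (hκ : κ + 2 * (1 / 4) ^ K ≤ CInf)
    (hG : GoodOn κ A (i - 2 * K - 50) (i + 2 * K + 50)) (hi : cInf < lam A i) :
    HasView A i repView ∨ HasView A i (mirror repView) := by
  have hpow : (0 : ℝ) < (1 / 4) ^ K := by positivity
  have hlow := le_cInf.trans_lt hi
  have hcentre : A i = 2 := by
    refine (hG i (by omega) (by omega)).1.resolve_left fun h1 => ?_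
    have h2 := (div_le_one (by linarith [one_le_cfVal (rightSeq A (i + 1)) fun _ => hA _])).2
      (one_le_cfVal (rightSeq A (i + 1)) fun _ => hA _)
    have h3 := (div_le_one (by linarith [one_le_cfVal (leftSeq A i) fun _ => hA _])).2
      (one_le_cfVal (leftSeq A i) fun _ => hA _)
    rw [lam_eq_digit_add hA, h1, lowerNum] at hlow
    norm_num at hlow h2 h3
    linarith
  obtain ⟨g, hg, hv⟩ := exists_goal_of_search hA (by linarith [CInf_le]) (fun _ => hlow) 35 []
    [2] (hG.mono (by simp; omega) (by simp; omega))
    ⟨trivial, by simpa [rightSeq] using hcentre, trivial⟩ search_from_centre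
  simp only [List.mem_cons, List.not_mem_nil, or_false] at hg
  rcases hg with rfl | rfl | rfl | rfl
  · exact Or.inl hv
  · exact Or.inr hv
  · exact absurd hv (not_hasView_maxView hA hκ (hG.mono (by omega) (by omega)))
  · refine absurd hv.of_mirror (not_hasView_maxView (A := reflect A) (fun _ => hA _) hκ ?_)
    exact (hG.mono (by omega) (by omega)).reflect hA

theorem hasView_repView_sub_nine (hA : ∀ n, 0 < A n) (hκ : κ + 2 * (1 / 4) ^ K ≤ CInf)
    (hG : GoodOn κ A (i - 2 * K - 50) (i + 2 * K + 50)) (hv : HasView A i repView) :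
    HasView A (i - 9) repView := by
  have hpow : (0 : ℝ) < (1 / 4) ^ K := by positivity
  have hv' := hv.moveLeft.moveLeft.moveLeft.moveLeft.moveLeft.moveLeft.moveLeft.moveLeft.moveLeft
  rw [show i - 1 - 1 - 1 - 1 - 1 - 1 - 1 - 1 - 1 = i - 9 by ring] at hv'
  obtain ⟨g, hg, hv⟩ := exists_goal_of_search hA (by linarith [CInf_le])
    (fun h => Bool.noConfusion h) 10 _ _ (hG.mono (by simp; omega) (by simp; omega)) hv'
    search_from_shifted_repView
  simp only [List.mem_cons, List.not_mem_nil, or_false] at hg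
  rcases hg with rfl | rfl
  · exact hv
  · exact absurd hv (not_hasView_maxView hA hκ (hG.mono (by omega) (by omega)))

theorem hasView_mirror_add_nine (hA : ∀ n, 0 < A n) (hκ : κ + 2 * (1 / 4) ^ K ≤ CInf)
    (hG : GoodOn κ A (i - 2 * K - 50) (i + 2 * K + 50)) (hv : HasView A i (mirror repView)) :
    HasView A (i + 9) (mirror repView) := by
  have h := hasView_repView_sub_nine (A := reflect A) (fun _ => hA _) hκ
    ((hG.mono (by omega) (by omega)).reflect hA) hv.of_mirror
  have h' := HasView.of_mirror (A := reflect A) (i := -i - 9) (l := (mirror repView).1) h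
  rwa [reflect_reflect, neg_sub, sub_neg_eq_add, add_comm] at h'

theorem lam_le_of_periodic (hA : ∀ n, 0 < A n)
    (hper : ∀ m, i - 2 * K - 10 ≤ m → m ≤ i + 2 * K → A (m + 9) = A m)
    (hv : HasView A i (mirror repView)) : lam A i ≤ cInf + 2 * (1 / 4) ^ K := by
  have hR : ∀ n, n ≤ 2 * K → rightSeq A i n = cRight n := by
    intro n
    induction n using Nat.strong_induction_on with
    | _ n ih =>
      intro hn
      rcases lt_or_ge n 9 with h | h
      · refine (hv.apply_right (h.trans (by decide))).trans ?_
        clear ih hn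
        revert n
        decide +kernel
      · obtain ⟨n, rfl⟩ := Nat.exists_eq_add_of_le' h
        refine .trans ?_ ((ih n (by omega) (by omega)).trans (perSeq_add_length _ n).symm)
        rw [rightSeq, rightSeq, ← hper (i + n) (by omega) (by omega)]
        congr 1
        push_cast
        ring
  have hL : ∀ n, n ≤ 2 * K → leftSeq A i n = cLeft n := by
    intro n
    induction n using Nat.strong_induction_on with
    | _ n ih =>
      intro hn
      rcases lt_or_ge n 9 with h | h
      · refine (hv.apply_left (h.trans (by decide))).trans ?_
        clear ih hn
        revert n
        decide +kernel
      · obtain ⟨n, rfl⟩ := Nat.exists_eq_add_of_le' h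
        refine .trans ?_ ((ih n (by omega) (by omega)).trans (perSeq_add_length _ n).symm)
        rw [leftSeq, leftSeq, ← hper (i - 1 - (n + 9 : ℕ)) (by omega) (by omega)]
        congr 1
        push_cast
        ring
  have hl := pos_of_one_or_two cLeft_one_or_two
  have h1 := (abs_le.1 (abs_cfVal_sub_le K (rightSeq A i) cRight (fun _ => hA _)
    (pos_of_one_or_two cRight_one_or_two) hR)).2
  have h2 := (abs_le.1 (abs_cfVal_sub_le K (leftSeq A i) cLeft (fun _ => hA _) hl hL)).1
  rw [lam_eq hA, cInf_eq]
  have h3 := one_div_le_one_div_add (δ := (1 / 4) ^ K) (by positivity)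
    (one_le_cfVal (leftSeq A i) fun _ => hA _) (one_le_cfVal cLeft hl) (by linarith)
  linarith

end Local

section Eventually

variable {κ : ℝ} {A : ℤ → ℕ} {K : ℕ}

theorem eventually_periodic_of_frequently_repView (hA : ∀ n, 0 < A n)
    (hκ : κ + 2 * (1 / 4) ^ K ≤ CInf) {N : ℤ} (hG : ∀ b, GoodOn κ A N b)
    (hv : ∃ᶠ i in atTop, HasView A i repView) :
    ∀ᶠ m in atTop, A (m + 9) = A m := by
  filter_upwards [eventually_ge_atTop (N + 2 * K + 100)] with m hm
  obtain ⟨i, hi, hvi⟩ := frequently_atTop.1 hv (m + 9)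
  have hall : ∀ k : ℕ, N + 2 * K + 60 ≤ i - 9 * k → HasView A (i - 9 * k) repView := by
    intro k
    induction k with
    | zero => intro; simpa using hvi
    | succ k ih =>
        intro hk
        push_cast at hk
        have := hasView_repView_sub_nine hA hκ
          ((hG (i - 9 * k + 2 * K + 50)).mono (by omega) le_rfl) (ih (by omega))
        rwa [show i - 9 * k - 9 = i - 9 * (k + 1 : ℕ) by push_cast; ring] at this
  obtain ⟨k, t, ht, hkt⟩ : ∃ k t : ℕ, t < 9 ∧ m + 9 = i - 9 * k + t :=
    ⟨((i - m - 9 + 8) / 9).toNat, (8 - (i - m - 9 + 8) % 9).toNat, by omega, by omega⟩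
  have e1 := (hall k (by omega)).apply_right (t := t) (ht.trans (by decide))
  have e2 := (hall (k + 1) (by push_cast; omega)).apply_right (t := t) (ht.trans (by decide))
  rw [hkt, e1, ← e2]
  congr 1
  push_cast
  omega

theorem eventually_periodic_of_mirror (hA : ∀ n, 0 < A n) (hκ : κ + 2 * (1 / 4) ^ K ≤ CInf)
    {N i : ℤ} (hG : ∀ b, GoodOn κ A N b) (hi : N + 2 * K + 50 ≤ i)
    (hv : HasView A i (mirror repView)) : ∀ᶠ m in atTop, A (m + 9) = A m := by
  have hall : ∀ k : ℕ, HasView A (i + 9 * k) (mirror repView) := by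
    intro k
    induction k with
    | zero => simpa using hv
    | succ k ih =>
        have := hasView_mirror_add_nine hA hκ
          ((hG (i + 9 * k + 2 * K + 50)).mono (by omega) le_rfl) ih
        rwa [show i + 9 * k + 9 = i + 9 * (k + 1 : ℕ) by push_cast; ring] at this
  filter_upwards [eventually_ge_atTop i] with m hm
  obtain ⟨k, t, ht, hkt⟩ : ∃ k t : ℕ, t < 9 ∧ m = i + 9 * k + t :=
    ⟨((m - i) / 9).toNat, ((m - i) % 9).toNat, by omega, by omega⟩
  have e1 := (hall k).apply_right (t := t) (ht.trans (by decide))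
  have e2 := (hall (k + 1)).apply_right (t := t) (ht.trans (by decide))
  rw [hkt, e1, ← e2]
  congr 1
  push_cast
  omega

theorem eventually_not_lt_lam (hA : ∀ n, 0 < A n) (hκ : κ + 2 * (1 / 4) ^ K ≤ CInf) {N : ℤ}
    (hG : ∀ b, GoodOn κ A N b) {c : ℝ} (hc : cInf + 2 * (1 / 4) ^ K < c) :
    ∀ᶠ i in atTop, ¬ c < lam A i := by
  have hpow : (0 : ℝ) < (1 / 4) ^ K := by positivity
  have hview : ∀ᶠ i in atTop, c < lam A i →
      HasView A i repView ∨ HasView A i (mirror repView) := by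
    filter_upwards [eventually_ge_atTop (N + 2 * K + 50)] with i hi hlt
    exact hasView_repView_or_mirror hA hκ ((hG _).mono (by omega) le_rfl) (by linarith)
  rw [← not_frequently]
  intro hfreq
  have hper : ∀ᶠ m in atTop, A (m + 9) = A m := by
    rcases frequently_or_distrib.1 ((hfreq.and_eventually hview).mono fun i h => h.2 h.1) with
      h | h
    · exact eventually_periodic_of_frequently_repView hA hκ hG h
    · obtain ⟨i, hi, hv⟩ := frequently_atTop.1 h (N + 2 * K + 50)
      exact eventually_periodic_of_mirror hA hκ hG hi hv
  obtain ⟨P, hP⟩ := eventually_atTop.1 hper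
  obtain ⟨i, ⟨hlt, hv⟩, hi⟩ :=
    ((hfreq.and_eventually hview).and_eventually (eventually_ge_atTop (P + 2 * K + 100))).exists
  have hle : lam A i ≤ cInf + 2 * (1 / 4) ^ K := by
    rcases hv hlt with hv | hv
    · rw [← lam_reflect hA]
      refine lam_le_of_periodic (fun _ => hA _) (fun m h1 h2 => ?_)
        (HasView.of_mirror (l := (mirror repView).1) hv)
      rw [reflect, reflect, neg_add, ← hP (-m + -9) (by omega), neg_add_cancel_right]
    · exact lam_le_of_periodic hA (fun m h1 h2 => hP m (by omega)) hv
  linarith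

theorem digit_lt_lam (hA : ∀ n, 0 < A n) (i : ℤ) : (A i : ℝ) < lam A i := by
  have h1 := one_le_cfVal (rightSeq A (i + 1)) fun _ => hA _
  have h2 := one_le_cfVal (leftSeq A i) fun _ => hA _
  have : 0 < 1 / cfVal (rightSeq A (i + 1)) := by positivity
  have : 0 < 1 / cfVal (leftSeq A i) := by positivity
  rw [lam_eq_digit_add hA]
  linarith

theorem digit_one_or_two (hA : ∀ n, 0 < A n) (hκ : κ ≤ 16 / 5) {i : ℤ}
    (h : ∀ j, i - 1 ≤ j → j ≤ i + 1 → lam A j < κ) : A i = 1 ∨ A i = 2 := by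
  have hle : ∀ j, i - 1 ≤ j → j ≤ i + 1 → A j ≤ 3 := fun j h1 h2 => by
    have : (A j : ℝ) < (4 : ℕ) := by
      push_cast
      linarith [digit_lt_lam hA j, h j h1 h2]
    exact Nat.lt_succ_iff.1 (by exact_mod_cast this)
  have inv_le : ∀ a : ℕ → ℕ, (∀ n, 0 < a n) → a 0 ≤ 3 → 1 / 4 ≤ 1 / cfVal a := by
    intro a ha h0
    have h1 := (cfVal_mem_Icc a fun _ => ha _).2
    have h0' : (a 0 : ℝ) ≤ 3 := by exact_mod_cast h0
    exact one_div_le_one_div_of_le (by linarith [one_le_cfVal a ha]) (by linarith)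
  have h3 := inv_le (rightSeq A (i + 1)) (fun _ => hA _)
    (by simpa [rightSeq] using hle (i + 1) (by omega) le_rfl)
  have h4 := inv_le (leftSeq A i) (fun _ => hA _)
    (by simpa [leftSeq] using hle (i - 1) le_rfl (by omega))
  have hi := h i (by omega) (by omega)
  rw [lam_eq_digit_add hA] at hi
  have : (A i : ℝ) < (3 : ℕ) := by push_cast; linarith
  have h5 : A i < 3 := by exact_mod_cast this
  have h6 := hA i
  omega

end Eventually

theorem lagrangeVal_notMem_Ioo {A : ℤ → ℕ} (hA : ∀ n, 0 < A n)
    (hb : IsBoundedUnder (· ≤ ·) atTop (lam A)) : lagrangeVal A ∉ Ioo cInf CInf := by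
  rintro ⟨h1, h2⟩
  obtain ⟨κ, hκ1, hκ2⟩ := exists_between h2
  obtain ⟨c, hc1, hc2⟩ := exists_between h1
  have hκ3 : κ ≤ 16 / 5 := by
    have := CInf_le
    rw [upperNum] at this
    norm_num at this
    linarith
  obtain ⟨M, hM⟩ := eventually_atTop.1 (eventually_lt_of_limsup_lt hκ1 hb)
  have hG : ∀ b, GoodOn κ A (M + 1) b := fun b j h3 _ =>
    ⟨digit_one_or_two hA hκ3 fun k hk _ => hM k (by omega), hM j (by omega)⟩
  have hcob : IsCoboundedUnder (· ≤ ·) atTop (lam A) :=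
    IsBoundedUnder.isCoboundedUnder_le
      (isBoundedUnder_of ⟨0, fun i => ((Nat.cast_nonneg _).trans (digit_lt_lam hA i).le)⟩)
  obtain ⟨K, hK⟩ := exists_pow_lt_of_lt_one
    (show 0 < min (CInf - κ) (c - cInf) / 2 from
      half_pos (lt_min (sub_pos.2 hκ2) (sub_pos.2 hc1))) (by norm_num : (1 / 4 : ℝ) < 1)
  have hK1 := min_le_left (CInf - κ) (c - cInf)
  have hK2 := min_le_right (CInf - κ) (c - cInf)
  exact frequently_lt_of_lt_limsup hcob hc2
    (eventually_not_lt_lam (K := K) hA (by linarith) hG (by linarith))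

/-- `L ∩ (c_∞, C_∞) = ∅`. -/
theorem lagrange_gap : LagrangeSpectrum ∩ Ioo cInf CInf = ∅ := by
  rw [← disjoint_iff_inter_eq_empty, disjoint_left]
  rintro _ ⟨A, hA, hb, rfl⟩
  exact lagrangeVal_notMem_Ioo hA hb
end

section
/- The Hausdorff dimension of the Gauss-Cantor set K({1_2, 2_2}) satisfies 0.2628 < HD(K({1_2, 2_2})) < 0.2646. -/
open Filter Set

open Topology NNReal ENNReal

/-! ### Coding of `Kset` by binary sequences -/

/-- The sequence of digits coded by `b`: the block `(1,1)` for `false`, `(2,2)` for `true`. -/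
def blockSeq (b : ℕ → Bool) (n : ℕ) : ℕ := if b (n / 2) then 2 else 1

/-- The branches `x ↦ [0; 1, 1 + x]` and `x ↦ [0; 2, 2 + x]` of the iterated function system. -/
noncomputable def branch (i : Bool) (x : ℝ) : ℝ :=
  if i then (2 + x) / (5 + 2 * x) else (1 + x) / (2 + x)

/-- The action of the matrix of a branch on a bottom row `(c, d)`. -/
def rowStep (i : Bool) (v : ℝ × ℝ) : ℝ × ℝ :=
  if i then (v.1 + 2 * v.2, 2 * v.1 + 5 * v.2) else (v.1 + v.2, v.1 + 2 * v.2)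

/-- The bottom row of the matrix of the composition of the first `n` branches coded by `b`. -/
def row (b : ℕ → Bool) : ℕ → ℝ × ℝ
  | 0 => (0, 1)
  | n + 1 => rowStep (b n) (row b n)

/-- The shift of `b` by `n`. -/
def shiftBy (b : ℕ → Bool) (n : ℕ) : ℕ → Bool := fun k => b (n + k)

/-- Convergents of `[0; g 0, g 1, ...]` for the block sequence `g` coded by `b`. -/
noncomputable def blockConv (b : ℕ → Bool) (n : ℕ) : ℝ :=
  cfConv (fun n => match n with | 0 => 0 | k + 1 => blockSeq b k) n

/-- The point of `Kset` coded by `b`. -/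
noncomputable def blockVal (b : ℕ → Bool) : ℝ := cf0 (blockSeq b)

lemma isBlockSeq_blockSeq (b : ℕ → Bool) : isBlockSeq (blockSeq b) := by
  intro n
  have h1 : 2 * n / 2 = n := by omega
  have h2 : (2 * n + 1) / 2 = n := by omega
  simp only [blockSeq, h1, h2]
  cases b n <;> simp

lemma exists_blockSeq_eq {g : ℕ → ℕ} (hg : isBlockSeq g) : ∃ b, blockSeq b = g := by
  refine ⟨fun n => decide (g (2 * n) = 2), funext fun n => ?_⟩
  have h := hg (n / 2)
  simp only [blockSeq, decide_eq_true_eq]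
  rcases Nat.even_or_odd' n with ⟨k, rfl | rfl⟩
  · have h1 : 2 * k / 2 = k := by omega
    rw [h1] at h ⊢
    rcases h with h | h <;> simp [h]
  · have h1 : (2 * k + 1) / 2 = k := by omega
    rw [h1] at h ⊢
    rcases h with h | h <;> simp [h]

lemma Kset_eq_range : Kset = range blockVal := by
  ext x
  constructor
  · rintro ⟨g, hg, rfl⟩
    obtain ⟨b, rfl⟩ := exists_blockSeq_eq hg
    exact ⟨b, rfl⟩
  · rintro ⟨b, rfl⟩
    exact ⟨_, isBlockSeq_blockSeq b, rfl⟩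

/-! ### Convergence of the convergents -/

lemma branch_mem_Icc (i : Bool) {x : ℝ} (hx : x ∈ Icc (0 : ℝ) 1) : branch i x ∈ Icc (0 : ℝ) 1 := by
  obtain ⟨h0, h1⟩ := hx
  cases i <;> simp only [branch, mem_Icc, if_true, Bool.false_eq_true, if_false]
  · exact ⟨by positivity, by rw [div_le_one (by positivity)]; linarith⟩
  · exact ⟨by positivity, by rw [div_le_one (by positivity)]; linarith⟩

lemma branch_sub_branch (i : Bool) {x y : ℝ} (hx : 0 ≤ x) (hy : 0 ≤ y) :
    (branch i x - branch i y) *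
      (((rowStep i (0, 1)).1 * x + (rowStep i (0, 1)).2) *
        ((rowStep i (0, 1)).1 * y + (rowStep i (0, 1)).2)) = x - y := by
  have h1 : 2 + x ≠ 0 := by positivity
  have h2 : 2 + y ≠ 0 := by positivity
  have h3 : 5 + 2 * x ≠ 0 := by positivity
  have h4 : 5 + 2 * y ≠ 0 := by positivity
  cases i <;> simp [branch, rowStep] <;> field_simp <;> ring

lemma abs_branch_sub_branch_le (i : Bool) {x y : ℝ} (hx : 0 ≤ x) (hy : 0 ≤ y) :
    |branch i x - branch i y| ≤ |x - y| / 4 := by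
  have h := branch_sub_branch i hx hy
  rw [← h, abs_mul, le_div_iff₀ (by norm_num)]
  refine mul_le_mul_of_nonneg_left (le_trans ?_ (le_abs_self _)) (abs_nonneg _)
  have hxy := mul_nonneg hx hy
  cases i <;> simp [rowStep] <;> nlinarith

lemma blockConv_zero (b : ℕ → Bool) : blockConv b 0 = 0 := by
  simp [blockConv, cfConv]

lemma blockConv_one_mem (b : ℕ → Bool) : blockConv b 1 ∈ Icc (0 : ℝ) 1 := by
  simp only [blockConv, cfConv, blockSeq]
  split_ifs <;> norm_num

lemma blockConv_add_two (b : ℕ → Bool) (n : ℕ) :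
    blockConv b (n + 2) = branch (b 0) (blockConv (shiftBy b 1) n) := by
  have key : ∀ m, cfConv (fun k => blockSeq b (k + 1)) m =
      (blockSeq b 1 : ℝ) + blockConv (shiftBy b 1) m := by
    intro m
    cases m with
    | zero => simp [blockConv, cfConv]
    | succ m =>
      simp only [blockConv, cfConv]
      have : (fun i => blockSeq b (i + 1 + 1)) = fun i => blockSeq (shiftBy b 1) i := by
        funext i
        have h : (i + 1 + 1) / 2 = 1 + i / 2 := by omega
        simp only [blockSeq, shiftBy, h]
        rfl
      simp [this]
  have hpos : 0 ≤ blockConv (shiftBy b 1) n := by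
    have hc : ∀ (n : ℕ) (a : ℕ → ℕ), 0 ≤ cfConv a n := by
      intro n
      induction n with
      | zero => intro a; simp [cfConv]
      | succ n ih => intro a; have := ih (fun i => a (i + 1)); simp only [cfConv]; positivity
    exact hc _ _
  have h2 : blockConv b (n + 2) =
      1 / ((blockSeq b 0 : ℝ) + 1 / ((blockSeq b 1 : ℝ) + blockConv (shiftBy b 1) n)) := by
    rw [← key]
    simp [blockConv, cfConv]
  rw [h2]
  generalize blockConv (shiftBy b 1) n = x at hpos
  have h1 : 2 + x ≠ 0 := by positivity
  have h3 : 5 + 2 * x ≠ 0 := by positivity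
  have h4 : 1 + x ≠ 0 := by positivity
  have h5 : 1 + x + 1 ≠ 0 := by positivity
  have h6 : 2 * (2 + x) + 1 ≠ 0 := by positivity
  cases hb : b 0 <;> simp [blockSeq, branch, hb] <;> field_simp <;> ring

lemma blockConv_mem (n : ℕ) (b : ℕ → Bool) : blockConv b n ∈ Icc (0 : ℝ) 1 := by
  induction n using Nat.twoStepInduction generalizing b with
  | zero => simp [blockConv_zero]
  | one => exact blockConv_one_mem b
  | more n ih _ =>
    rw [blockConv_add_two]
    exact branch_mem_Icc _ (ih _)

lemma abs_blockConv_sub_le (k m n : ℕ) (b : ℕ → Bool) :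
    |blockConv b (m + 2 * k) - blockConv b (n + 2 * k)| ≤ (1 / 4) ^ k := by
  induction k generalizing b with
  | zero =>
    have h1 := blockConv_mem m b
    have h2 := blockConv_mem n b
    simp only [mem_Icc] at h1 h2
    rw [abs_le]
    constructor <;> simp <;> linarith
  | succ k ih =>
    have e : ∀ j, j + 2 * (k + 1) = (j + 2 * k) + 2 := by intro j; ring
    rw [e, e, blockConv_add_two, blockConv_add_two]
    refine (abs_branch_sub_branch_le _ (blockConv_mem _ _).1 (blockConv_mem _ _).1).trans ?_
    have := ih (shiftBy b 1)
    rw [pow_succ]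
    linarith

lemma tendsto_blockConv (b : ℕ → Bool) : Tendsto (blockConv b) atTop (𝓝 (blockVal b)) := by
  have hc : CauchySeq (blockConv b) := by
    refine Metric.cauchySeq_iff'.2 fun ε hε => ?_
    obtain ⟨k, hk⟩ := exists_pow_lt_of_lt_one hε (by norm_num : (1 / 4 : ℝ) < 1)
    refine ⟨0 + 2 * k, fun n hn => ?_⟩
    obtain ⟨m, rfl⟩ := Nat.exists_eq_add_of_le hn
    rw [Real.dist_eq, zero_add, add_comm (2 * k) m]
    have := abs_blockConv_sub_le k m 0 b
    rw [zero_add] at this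
    exact this.trans_lt hk
  exact hc.tendsto_limUnder

lemma blockVal_mem (b : ℕ → Bool) : blockVal b ∈ Icc (0 : ℝ) 1 :=
  isClosed_Icc.mem_of_tendsto (tendsto_blockConv b) (Eventually.of_forall fun n => blockConv_mem n b)

lemma blockVal_eq (b : ℕ → Bool) : blockVal b = branch (b 0) (blockVal (shiftBy b 1)) := by
  have h1 : Tendsto (fun n => blockConv b (n + 2)) atTop (𝓝 (blockVal b)) :=
    (tendsto_add_atTop_iff_nat 2).2 (tendsto_blockConv b)
  refine tendsto_nhds_unique h1 ?_
  simp only [blockConv_add_two]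
  refine tendsto_iff_dist_tendsto_zero.2 ?_
  have h2 := tendsto_iff_dist_tendsto_zero.1 (tendsto_blockConv (shiftBy b 1))
  refine squeeze_zero (fun _ => dist_nonneg) (fun n => ?_) h2
  rw [Real.dist_eq, Real.dist_eq]
  refine (abs_branch_sub_branch_le _ (blockConv_mem _ _).1 (blockVal_mem _).1).trans ?_
  linarith [abs_nonneg (blockConv (shiftBy b 1) n - blockVal (shiftBy b 1))]

/-! ### Bottom rows -/

/-- The cone that contains all bottom rows. -/
def rowCone : Set (ℝ × ℝ) := {v | 0 ≤ v.1 ∧ 3 * v.1 ≤ 2 * v.2 ∧ 0 < v.2}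

lemma rowStep_mem (i : Bool) {v : ℝ × ℝ} (hv : v ∈ rowCone) : rowStep i v ∈ rowCone := by
  obtain ⟨h1, h2, h3⟩ := hv
  cases i <;> simp only [rowCone, rowStep, mem_ofPred_eq, if_true, Bool.false_eq_true, if_false] <;>
    refine ⟨by linarith, by linarith, by linarith⟩

lemma row_mem (b : ℕ → Bool) (n : ℕ) : row b n ∈ rowCone := by
  induction n with
  | zero => simp [row, rowCone]
  | succ n ih => exact rowStep_mem _ ih

lemma two_pow_le_row (b : ℕ → Bool) (n : ℕ) : 2 ^ n ≤ (row b n).2 := by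
  induction n with
  | zero => simp [row]
  | succ n ih =>
    have h := row_mem b n
    obtain ⟨h1, h2, h3⟩ := h
    rw [pow_succ]
    cases hb : b n <;> simp [row, rowStep, hb] <;> linarith

lemma row_congr {b b' : ℕ → Bool} {n : ℕ} (h : ∀ k < n, b k = b' k) : row b n = row b' n := by
  induction n with
  | zero => rfl
  | succ n ih => rw [row, row, ih fun k hk => h k (by omega), h n (by omega)]

lemma shiftBy_one_shiftBy (b : ℕ → Bool) (n : ℕ) : shiftBy (shiftBy b n) 1 = shiftBy b (n + 1) := by
  funext k
  simp [shiftBy, add_assoc]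

lemma blockVal_sub_blockVal {b b' : ℕ → Bool} {n : ℕ} (h : ∀ k < n, b k = b' k) :
    (blockVal b - blockVal b') *
      (((row b n).1 * blockVal (shiftBy b n) + (row b n).2) *
        ((row b n).1 * blockVal (shiftBy b' n) + (row b n).2)) =
      blockVal (shiftBy b n) - blockVal (shiftBy b' n) := by
  induction n with
  | zero =>
    have : ∀ b, shiftBy b 0 = b := by intro b; funext k; simp [shiftBy]
    simp [row, this]
  | succ n ih =>
    have ih := ih fun k hk => h k (by omega)
    have e : ∀ b, blockVal (shiftBy b n) = branch (b n) (blockVal (shiftBy b (n + 1))) := by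
      intro b
      rw [blockVal_eq (shiftBy b n), shiftBy_one_shiftBy]
      rfl
    rw [e, e b', ← h n (by omega)] at ih
    have hx := (blockVal_mem (shiftBy b (n + 1))).1
    have hy := (blockVal_mem (shiftBy b' (n + 1))).1
    rw [row]
    generalize blockVal (shiftBy b (n + 1)) = x at *
    generalize blockVal (shiftBy b' (n + 1)) = y at *
    generalize row b n = v at *
    obtain ⟨c, d⟩ := v
    rw [← branch_sub_branch (b n) hx hy, ← ih]
    have h1 : 2 + x ≠ 0 := by positivity
    have h2 : 2 + y ≠ 0 := by positivity
    have h3 : 5 + 2 * x ≠ 0 := by positivity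
    have h4 : 5 + 2 * y ≠ 0 := by positivity
    cases b n <;> simp [branch, rowStep] <;> field_simp <;> ring_nf

/-! ### The weight of a row -/

/-- The approximate eigenfunction of the transfer operator with parameter `p / 2`. -/
noncomputable def rowWeight (p : ℝ) (v : ℝ × ℝ) : ℝ := (10 * v.1 + 19 * v.2) ^ (-p)

lemma rowWeight_pos (p : ℝ) {v : ℝ × ℝ} (hv : v ∈ rowCone) : 0 < rowWeight p v := by
  obtain ⟨h1, h2, h3⟩ := hv
  exact Real.rpow_pos_of_pos (by positivity) _

lemma rpow_neg_tangent {p u x : ℝ} (hp0 : 0 ≤ p) (hp1 : p ≤ 1) (hu : 0 < u) (hx : 0 < x) :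
    u ^ (-p) * (1 - p * (x / u - 1)) ≤ x ^ (-p) := by
  have hxu : 0 < x / u := by positivity
  have hb := rpow_one_add_le_one_add_mul_self (s := x / u - 1) (by linarith) hp0 hp1
  rw [add_sub_cancel] at hb
  have hpos : 0 < (x / u) ^ p := Real.rpow_pos_of_pos hxu p
  have e : x ^ (-p) = u ^ (-p) * ((x / u) ^ p)⁻¹ := by
    rw [← Real.rpow_neg hxu.le, ← Real.mul_rpow hu.le hxu.le, mul_div_cancel₀ _ hu.ne']
  rw [e]
  refine mul_le_mul_of_nonneg_left ?_ (Real.rpow_nonneg hu.le _)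
  rw [← one_div, le_div_iff₀ hpos]
  nlinarith [sq_nonneg (p * (x / u - 1))]

lemma rpow_neg_div_le {m n : ℕ} {u q : ℝ} (hn : n ≠ 0) (hu : 0 < u) (hq : 0 < q)
    (h : 1 ≤ q ^ n * u ^ m) : u ^ (-(m / n : ℝ)) ≤ q := by
  have hn' : (n : ℝ) ≠ 0 := by exact_mod_cast hn
  rw [← pow_le_pow_iff_left₀ (Real.rpow_nonneg hu.le _) hq.le hn, ← Real.rpow_natCast,
    ← Real.rpow_mul hu.le, neg_mul, div_mul_cancel₀ _ hn', Real.rpow_neg hu.le, Real.rpow_natCast,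
    ← one_div, div_le_iff₀ (by positivity)]
  exact h

lemma le_rpow_neg_div {m n : ℕ} {u q : ℝ} (hn : n ≠ 0) (hu : 0 < u) (hq : 0 < q)
    (h : q ^ n * u ^ m ≤ 1) : q ≤ u ^ (-(m / n : ℝ)) := by
  have hn' : (n : ℝ) ≠ 0 := by exact_mod_cast hn
  rw [← pow_le_pow_iff_left₀ hq.le (Real.rpow_nonneg hu.le _) hn, ← Real.rpow_natCast (_ ^ _),
    ← Real.rpow_mul hu.le, neg_mul, div_mul_cancel₀ _ hn', Real.rpow_neg hu.le, Real.rpow_natCast,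
    ← one_div, le_div_iff₀ (by positivity)]
  exact h

lemma rpow_neg_chord {p a b u w x : ℝ} (hp0 : 0 ≤ p) (hp1 : p ≤ 1) (ha : 0 ≤ a) (hb : 0 ≤ b)
    (hu : 0 < u) (hw : 0 < w) (hx : 0 < x) (h : (a + b) * x = a * u + b * w) :
    (a + b) * x ^ (-p) ≤ a * u ^ (-p) + b * w ^ (-p) := by
  have h1 := mul_le_mul_of_nonneg_left (rpow_neg_tangent hp0 hp1 hx hu) ha
  have h2 := mul_le_mul_of_nonneg_left (rpow_neg_tangent hp0 hp1 hx hw) hb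
  have e : a * (x ^ (-p) * (1 - p * (u / x - 1))) + b * (x ^ (-p) * (1 - p * (w / x - 1))) =
      (a + b) * x ^ (-p) + x ^ (-p) * p * ((a + b) * x - (a * u + b * w)) / x := by
    field_simp
    ring
  rw [h, sub_self, mul_zero, zero_div, add_zero] at e
  linarith

lemma rowWeight_rowStep (p : ℝ) {v : ℝ × ℝ} (hv : v ∈ rowCone) :
    rowWeight p (rowStep false v) + rowWeight p (rowStep true v) =
      rowWeight p v * (((29 * v.1 + 48 * v.2) / (10 * v.1 + 19 * v.2)) ^ (-p) +
        ((48 * v.1 + 115 * v.2) / (10 * v.1 + 19 * v.2)) ^ (-p)) := by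
  obtain ⟨h1, h2, h3⟩ := hv
  have hD : 0 < 10 * v.1 + 19 * v.2 := by positivity
  rw [mul_add, rowWeight, rowWeight, rowWeight, ← Real.mul_rpow hD.le (by positivity),
    ← Real.mul_rpow hD.le (by positivity), mul_div_cancel₀ _ hD.ne', mul_div_cancel₀ _ hD.ne']
  simp only [rowStep, if_true, Bool.false_eq_true, if_false]
  congr 2 <;> ring

lemma rowWeight_le {v : ℝ × ℝ} (hv : v ∈ rowCone) :
    rowWeight (10 / 19) v ≤
      rowWeight (10 / 19) (rowStep false v) + rowWeight (10 / 19) (rowStep true v) := by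
  rw [rowWeight_rowStep _ hv]
  refine le_mul_of_one_le_right (rowWeight_pos _ hv).le ?_
  obtain ⟨h1, h2, h3⟩ := hv
  obtain ⟨c, d⟩ := v
  simp only at *
  have hD : 0 < 10 * c + 19 * d := by positivity
  have q1 : (0.6083 : ℝ) ≤ (18 / 7) ^ (-(10 / 19) : ℝ) := by
    have := le_rpow_neg_div (m := 10) (n := 19) (u := 18 / 7) (q := 0.6083)
      (by norm_num) (by norm_num) (by norm_num) (by norm_num)
    exact_mod_cast this
  have q2 : (0.3894 : ℝ) ≤ 6 ^ (-(10 / 19) : ℝ) := by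
    have := le_rpow_neg_div (m := 10) (n := 19) (u := 6) (q := 0.3894)
      (by norm_num) (by norm_num) (by norm_num) (by norm_num)
    exact_mod_cast this
  have hA : (29 * c + 48 * d) / (10 * c + 19 * d) ≤ 2.7 := by
    rw [div_le_iff₀ hD]; linarith
  have hB : (48 * c + 115 * d) / (10 * c + 19 * d) ≤ 6.1 := by
    rw [div_le_iff₀ hD]; linarith
  have t1 := rpow_neg_tangent (p := 10 / 19) (u := 18 / 7)
    (x := (29 * c + 48 * d) / (10 * c + 19 * d)) (by norm_num) (by norm_num) (by norm_num)
    (by positivity)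
  have t2 := rpow_neg_tangent (p := 10 / 19) (u := 6)
    (x := (48 * c + 115 * d) / (10 * c + 19 * d)) (by norm_num) (by norm_num) (by norm_num)
    (by positivity)
  have s1 := (mul_le_mul_of_nonneg_right q1 (by linarith)).trans t1
  have s2 := (mul_le_mul_of_nonneg_right q2 (by linarith)).trans t2
  refine le_trans ?_ (add_le_add s1 s2)
  have key : 0.6083 * (35 / 171) * ((29 * c + 48 * d) / (10 * c + 19 * d)) +
      0.3894 * (5 / 57) * ((48 * c + 115 * d) / (10 * c + 19 * d)) ≤
      (0.6083 + 0.3894) * (29 / 19) - 1 := by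
    rw [mul_div_assoc' _ (29 * c + 48 * d), mul_div_assoc' _ (48 * c + 115 * d), ← add_div,
      div_le_iff₀ hD]
    linarith
  linarith

lemma rowWeight_ge {v : ℝ × ℝ} (hv : v ∈ rowCone) :
    rowWeight (37 / 70) (rowStep false v) + rowWeight (37 / 70) (rowStep true v) ≤
      rowWeight (37 / 70) v := by
  rw [rowWeight_rowStep _ hv]
  refine mul_le_of_le_one_right (rowWeight_pos _ hv).le ?_
  obtain ⟨h1, h2, h3⟩ := hv
  obtain ⟨c, d⟩ := v
  simp only at *
  have hD : 0 < 10 * c + 19 * d := by positivity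
  have num : ∀ u q : ℝ, 0 < u → 0 < q → 1 ≤ q ^ 70 * u ^ 37 → u ^ (-(37 / 70) : ℝ) ≤ q := by
    intro u q hu hq h
    have := rpow_neg_div_le (m := 37) (n := 70) (by norm_num) hu hq h
    exact_mod_cast this
  have q1 := num (48 / 19) 0.6128 (by norm_num) (by norm_num) (by norm_num)
  have q2 := num (115 / 19) 0.3861 (by norm_num) (by norm_num) (by norm_num)
  have q3 := num (202 / 77) 0.6007 (by norm_num) (by norm_num) (by norm_num)
  have q4 := num (441 / 77) 0.3976 (by norm_num) (by norm_num) (by norm_num)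
  have ha : 0 ≤ 19 * (d - 3 / 2 * c) := by linarith
  have hb : 0 ≤ 77 * (c / 2) := by linarith
  have e : 19 * (d - 3 / 2 * c) + 77 * (c / 2) = 10 * c + 19 * d := by ring
  have t1 := rpow_neg_chord (p := 37 / 70) (u := 48 / 19) (w := 202 / 77)
    (x := (29 * c + 48 * d) / (10 * c + 19 * d)) (by norm_num) (by norm_num) ha hb
    (by norm_num) (by norm_num) (by positivity) (by rw [e, mul_div_cancel₀ _ hD.ne']; ring)
  have t2 := rpow_neg_chord (p := 37 / 70) (u := 115 / 19) (w := 441 / 77)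
    (x := (48 * c + 115 * d) / (10 * c + 19 * d)) (by norm_num) (by norm_num) ha hb
    (by norm_num) (by norm_num) (by positivity) (by rw [e, mul_div_cancel₀ _ hD.ne']; ring)
  rw [e] at t1 t2
  have s1 := mul_le_mul_of_nonneg_left q1 ha
  have s2 := mul_le_mul_of_nonneg_left q2 ha
  have s3 := mul_le_mul_of_nonneg_left q3 hb
  have s4 := mul_le_mul_of_nonneg_left q4 hb
  refine le_of_mul_le_mul_left ?_ hD
  rw [mul_add]
  linarith

/-! ### The upper bound -/

/-- The infinite word that continues the finite word `w` by `false`. -/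
def extendWord {n : ℕ} (w : Fin n → Bool) (k : ℕ) : Bool :=
  if h : k < n then w ⟨k, h⟩ else false

lemma extendWord_snoc_row {n : ℕ} (w : Fin n → Bool) (i : Bool) :
    row (extendWord (Fin.snoc w i : Fin (n + 1) → Bool)) (n + 1) =
      rowStep i (row (extendWord w) n) := by
  have h : ∀ k < n, extendWord (Fin.snoc w i : Fin (n + 1) → Bool) k = extendWord w k := by
    intro k hk
    have hk' : k < n + 1 := by omega
    simp [extendWord, hk, hk', Fin.snoc]
  rw [row, row_congr h]
  simp [extendWord, Fin.snoc]

lemma sum_rowWeight_le (n : ℕ) :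
    ∑ w : Fin n → Bool, rowWeight (37 / 70) (row (extendWord w) n) ≤ rowWeight (37 / 70) (0, 1) := by
  induction n with
  | zero => simp [row]
  | succ n ih =>
    refine le_trans ?_ ih
    rw [← (Fin.snocEquiv fun _ : Fin (n + 1) => Bool).sum_comp, Fintype.sum_prod_type,
      Fintype.sum_bool, ← Finset.sum_add_distrib]
    refine Finset.sum_le_sum fun w _ => ?_
    simp only [Fin.snocEquiv, Equiv.coe_fn_mk]
    rw [extendWord_snoc_row, extendWord_snoc_row, add_comm]
    exact rowWeight_ge (row_mem _ _)

/-- The points of `Kset` whose code begins with `w`. -/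
def cylinder {n : ℕ} (w : Fin n → Bool) : Set ℝ :=
  blockVal '' {b | ∀ k : Fin n, b k = w k}

lemma ediam_cylinder_le {n : ℕ} (w : Fin n → Bool) :
    Metric.ediam (cylinder w) ≤ ENNReal.ofReal (((row (extendWord w) n).2 ^ 2)⁻¹) := by
  refine Metric.ediam_le ?_
  rintro _ ⟨b, hb, rfl⟩ _ ⟨b', hb', rfl⟩
  rw [edist_dist, Real.dist_eq]
  refine ENNReal.ofReal_le_ofReal ?_
  have hbw : ∀ k < n, b k = extendWord w k := fun k hk => by
    simpa [extendWord, hk] using hb ⟨k, hk⟩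
  have hbb : ∀ k < n, b k = b' k := fun k hk => (hb ⟨k, hk⟩).trans (hb' ⟨k, hk⟩).symm
  have h := blockVal_sub_blockVal hbb
  rw [row_congr hbw] at h
  obtain ⟨h1, h2, h3⟩ := row_mem (extendWord w) n
  have hx := blockVal_mem (shiftBy b n)
  have hy := blockVal_mem (shiftBy b' n)
  generalize row (extendWord w) n = v at *
  generalize blockVal (shiftBy b n) = x at *
  generalize blockVal (shiftBy b' n) = y at *
  obtain ⟨hx0, hx1⟩ := hx
  obtain ⟨hy0, hy1⟩ := hy
  have hxy : |x - y| ≤ 1 := by rw [abs_le]; constructor <;> linarith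
  rw [← h, abs_mul] at hxy
  rw [← one_div, le_div_iff₀ (by positivity)]
  refine le_trans (mul_le_mul_of_nonneg_left (le_trans ?_ (le_abs_self _)) (abs_nonneg _)) hxy
  rw [sq]
  have := mul_nonneg h1 hx0
  have := mul_nonneg h1 hy0
  gcongr <;> linarith

lemma Kset_subset_iUnion_cylinder (n : ℕ) : Kset ⊆ ⋃ w : Fin n → Bool, cylinder w := by
  rw [Kset_eq_range]
  rintro _ ⟨b, rfl⟩
  exact mem_iUnion.2 ⟨fun k => b k, b, fun _ => rfl, rfl⟩

lemma ediam_cylinder_rpow_le {n : ℕ} (w : Fin n → Bool) :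
    Metric.ediam (cylinder w) ^ (37 / 140 : ℝ) ≤
      ENNReal.ofReal (29 ^ (37 / 70 : ℝ) * rowWeight (37 / 70) (row (extendWord w) n)) := by
  refine (ENNReal.rpow_le_rpow (ediam_cylinder_le w) (by norm_num)).trans ?_
  obtain ⟨h1, h2, h3⟩ := row_mem (extendWord w) n
  generalize row (extendWord w) n = v at *
  rw [ENNReal.ofReal_rpow_of_nonneg (by positivity) (by norm_num)]
  refine ENNReal.ofReal_le_ofReal ?_
  have e : ((v.2 ^ 2)⁻¹) ^ (37 / 140 : ℝ) = 29 ^ (37 / 70 : ℝ) * (29 * v.2) ^ (-(37 / 70) : ℝ) := by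
    rw [Real.mul_rpow (by norm_num) h3.le, ← mul_assoc, ← Real.rpow_add (by norm_num),
      Real.inv_rpow (by positivity), ← Real.rpow_natCast, ← Real.rpow_mul h3.le,
      ← Real.rpow_neg h3.le]
    norm_num
  rw [e, rowWeight]
  refine mul_le_mul_of_nonneg_left ?_ (by positivity)
  exact Real.rpow_le_rpow_of_nonpos (by positivity) (by linarith) (by norm_num)

lemma dimH_Kset_le : dimH Kset ≤ ENNReal.ofReal (37 / 140) := by
  have hfin : MeasureTheory.Measure.hausdorffMeasure (37 / 140 : ℝ) Kset ≤
      ENNReal.ofReal (29 ^ (37 / 70 : ℝ) * rowWeight (37 / 70) (0, 1)) := by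
    have hr : Tendsto (fun n : ℕ => ENNReal.ofReal ((1 / 4) ^ n)) atTop (𝓝 0) := by
      rw [← ENNReal.ofReal_zero]
      exact (ENNReal.continuous_ofReal.tendsto 0).comp
        (tendsto_pow_atTop_nhds_zero_of_lt_one (by norm_num) (by norm_num))
    refine (MeasureTheory.Measure.hausdorffMeasure_le_liminf_sum (ι := fun n => Fin n → Bool) _ _
      (fun n : ℕ => ENNReal.ofReal ((1 / 4) ^ n)) hr (fun n w => cylinder w)
      (Eventually.of_forall fun n w => (ediam_cylinder_le w).trans (ENNReal.ofReal_le_ofReal ?_))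
      (Eventually.of_forall Kset_subset_iUnion_cylinder)).trans ?_
    · have h := two_pow_le_row (extendWord w) n
      rw [one_div, inv_pow]
      refine inv_anti₀ (by positivity) ?_
      calc (4 : ℝ) ^ n = (2 ^ n) ^ 2 := by rw [← pow_mul, mul_comm, pow_mul]; norm_num
        _ ≤ _ := by gcongr
    · refine liminf_le_of_frequently_le' (Frequently.of_forall fun n => ?_)
      refine (Finset.sum_le_sum fun w _ => ediam_cylinder_rpow_le w).trans ?_
      rw [← ENNReal.ofReal_sum_of_nonneg fun w _ =>
        mul_nonneg (by positivity) (rowWeight_pos _ (row_mem _ _)).le, ← Finset.mul_sum]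
      exact ENNReal.ofReal_le_ofReal (mul_le_mul_of_nonneg_left (sum_rowWeight_le n)
        (by positivity))
  have hcoe : ((Real.toNNReal (37 / 140) : ℝ≥0) : ℝ) = 37 / 140 :=
    Real.coe_toNNReal _ (by norm_num)
  refine dimH_le_of_hausdorffMeasure_ne_top (d := Real.toNNReal (37 / 140)) ?_
  rw [hcoe]
  exact (hfin.trans_lt ENNReal.ofReal_lt_top).ne

/-! ### The lower bound -/

/-- The row reached after `n` steps, and the remaining weight, when `t` is expanded greedily with
respect to the weights of the rows. -/
noncomputable def expansion (t : ℝ) : ℕ → (ℝ × ℝ) × ℝ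
  | 0 => ((0, 1), t)
  | n + 1 =>
    let s := expansion t n
    if s.2 < rowWeight (10 / 19) (rowStep false s.1) then (rowStep false s.1, s.2)
    else (rowStep true s.1, s.2 - rowWeight (10 / 19) (rowStep false s.1))

open Classical in
/-- The digits of the expansion of `t`. -/
noncomputable def expansionDigit (t : ℝ) (n : ℕ) : Bool :=
  decide (¬ (expansion t n).2 < rowWeight (10 / 19) (rowStep false (expansion t n).1))

lemma row_expansionDigit (t : ℝ) (n : ℕ) : row (expansionDigit t) n = (expansion t n).1 := by
  induction n with
  | zero => rfl
  | succ n ih =>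
    rw [row, ih, expansion, expansionDigit]
    by_cases h : (expansion t n).2 < rowWeight (10 / 19) (rowStep false (expansion t n).1) <;>
      simp [h]

lemma expansion_mem {t : ℝ} (ht : t ∈ Icc 0 (rowWeight (10 / 19) (0, 1))) (n : ℕ) :
    (expansion t n).2 ∈ Icc 0 (rowWeight (10 / 19) (expansion t n).1) := by
  induction n with
  | zero => exact ht
  | succ n ih =>
    have hv : (expansion t n).1 ∈ rowCone := row_expansionDigit t n ▸ row_mem _ _
    have hw := rowWeight_le hv
    obtain ⟨h0, h1⟩ := ih
    rw [expansion]
    by_cases h : (expansion t n).2 < rowWeight (10 / 19) (rowStep false (expansion t n).1)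
    · simp only [h, if_true]
      exact ⟨h0, h.le⟩
    · simp only [h, if_false]
      push Not at h
      exact ⟨by linarith, by linarith⟩

lemma expansion_sub {t t' : ℝ} {n : ℕ} (h : ∀ k < n, expansionDigit t k = expansionDigit t' k) :
    (expansion t n).2 - (expansion t' n).2 = t - t' := by
  induction n with
  | zero => rfl
  | succ n ih =>
    have ih := ih fun k hk => h k (by omega)
    have e : (expansion t n).1 = (expansion t' n).1 := by
      rw [← row_expansionDigit, ← row_expansionDigit, row_congr fun k hk => h k (by omega)]
    have hn := h n (by omega)
    simp only [expansionDigit, e, decide_eq_decide, not_iff_not] at hn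
    rw [expansion, expansion]
    simp only [e]
    by_cases h' : (expansion t n).2 < rowWeight (10 / 19) (rowStep false (expansion t' n).1)
    · simpa only [h', hn.1 h', if_true] using ih
    · simp only [h', mt hn.2 h', if_false]
      linarith

lemma abs_sub_le_of_digits_eq {t t' : ℝ} (ht : t ∈ Icc 0 (rowWeight (10 / 19) (0, 1)))
    (ht' : t' ∈ Icc 0 (rowWeight (10 / 19) (0, 1))) {n : ℕ}
    (h : ∀ k < n, expansionDigit t k = expansionDigit t' k) :
    |t - t'| ≤ (row (expansionDigit t) n).2 ^ (-(10 / 19) : ℝ) := by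
  have h1 := expansion_mem ht n
  have h2 := expansion_mem ht' n
  rw [← row_expansionDigit] at h1 h2
  rw [← row_congr h] at h2
  rw [← expansion_sub h]
  obtain ⟨v1, v2, v3⟩ := row_mem (expansionDigit t) n
  have hw : rowWeight (10 / 19) (row (expansionDigit t) n) ≤
      (row (expansionDigit t) n).2 ^ (-(10 / 19) : ℝ) :=
    Real.rpow_le_rpow_of_nonpos v3 (by linarith) (by norm_num)
  obtain ⟨_, _⟩ := h1
  obtain ⟨_, _⟩ := h2
  rw [abs_le]
  constructor <;> linarith

lemma branch_gap {x y : ℝ} (hx : x ∈ Icc (0 : ℝ) 1) (hy : y ∈ Icc (0 : ℝ) 1) :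
    1 / 14 ≤ branch false x - branch true y := by
  obtain ⟨hx0, hx1⟩ := hx
  obtain ⟨hy0, hy1⟩ := hy
  have h1 : 1 / 2 ≤ branch false x := by
    simp only [branch, Bool.false_eq_true, if_false]
    rw [div_le_div_iff₀ (by norm_num) (by positivity)]
    linarith
  have h2 : branch true y ≤ 3 / 7 := by
    simp only [branch, if_true]
    rw [div_le_div_iff₀ (by positivity) (by norm_num)]
    linarith
  linarith

lemma inv_sq_le_abs_blockVal_sub {b b' : ℕ → Bool} {n : ℕ} (h : ∀ k < n, b k = b' k)
    (hn : b n ≠ b' n) : ((row b n).2 ^ 2)⁻¹ ≤ 56 * |blockVal b - blockVal b'| := by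
  have key := blockVal_sub_blockVal h
  obtain ⟨v1, v2, v3⟩ := row_mem b n
  have hx := blockVal_mem (shiftBy b n)
  have hy := blockVal_mem (shiftBy b' n)
  have gap : 1 / 14 ≤ |blockVal (shiftBy b n) - blockVal (shiftBy b' n)| := by
    rw [blockVal_eq (shiftBy b n), blockVal_eq (shiftBy b' n)]
    simp only [shiftBy, add_zero]
    cases hb : b n <;> cases hb' : b' n <;> simp only [hb, hb', ne_eq, not_true_eq_false] at hn
    · exact (branch_gap (blockVal_mem _) (blockVal_mem _)).trans (le_abs_self _)
    · rw [abs_sub_comm]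
      exact (branch_gap (blockVal_mem _) (blockVal_mem _)).trans (le_abs_self _)
  rw [← key, abs_mul] at gap
  generalize row b n = v at *
  generalize blockVal (shiftBy b n) = x at *
  generalize blockVal (shiftBy b' n) = y at *
  obtain ⟨hx0, hx1⟩ := hx
  obtain ⟨hy0, hy1⟩ := hy
  have m1 := mul_le_mul_of_nonneg_left hx1 v1
  have m2 := mul_le_mul_of_nonneg_left hy1 v1
  have hprod : (v.1 * x + v.2) * (v.1 * y + v.2) ≤ (2 * v.2) * (2 * v.2) := by
    gcongr <;> linarith
  rw [abs_of_nonneg (a := (v.1 * x + v.2) * (v.1 * y + v.2)) (by positivity)] at gap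
  have := gap.trans (mul_le_mul_of_nonneg_left hprod (abs_nonneg _))
  rw [← one_div, div_le_iff₀ (by positivity)]
  linarith

lemma abs_sub_le_abs_blockVal_sub_rpow {t t' : ℝ} (ht : t ∈ Icc 0 (rowWeight (10 / 19) (0, 1)))
    (ht' : t' ∈ Icc 0 (rowWeight (10 / 19) (0, 1))) :
    |t - t'| ≤ 56 ^ (5 / 19 : ℝ) *
      |blockVal (expansionDigit t) - blockVal (expansionDigit t')| ^ (5 / 19 : ℝ) := by
  by_cases h : ∃ n, expansionDigit t n ≠ expansionDigit t' n
  · classical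
    have hn := Nat.find_spec h
    have hlt : ∀ k < Nat.find h, expansionDigit t k = expansionDigit t' k := fun k hk =>
      not_not.1 (Nat.find_min h hk)
    refine (abs_sub_le_of_digits_eq ht ht' hlt).trans ?_
    have h2 := inv_sq_le_abs_blockVal_sub hlt hn
    obtain ⟨_, _, v3⟩ := row_mem (expansionDigit t) (Nat.find h)
    rw [← Real.mul_rpow (by norm_num) (abs_nonneg _)]
    refine le_trans (le_of_eq ?_) (Real.rpow_le_rpow (by positivity) h2 (by norm_num))
    rw [Real.inv_rpow (by positivity), ← Real.rpow_natCast, ← Real.rpow_mul v3.le,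
      ← Real.rpow_neg v3.le]
    norm_num
  · push Not at h
    have hle : ∀ n : ℕ, |t - t'| ≤ ((2 : ℝ) ^ (-(10 / 19) : ℝ)) ^ n := fun n => by
      refine (abs_sub_le_of_digits_eq ht ht' (n := n) fun k _ => h k).trans ?_
      refine (Real.rpow_le_rpow_of_nonpos (by positivity) (two_pow_le_row _ n)
        (by norm_num)).trans (le_of_eq ?_)
      rw [← Real.rpow_natCast, ← Real.rpow_natCast, ← Real.rpow_mul (by norm_num),
        ← Real.rpow_mul (by norm_num), mul_comm]
    have h0 : |t - t'| ≤ 0 := ge_of_tendsto'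
      (tendsto_pow_atTop_nhds_zero_of_lt_one (by positivity)
        (Real.rpow_lt_one_of_one_lt_of_neg (by norm_num) (by norm_num))) hle
    exact h0.trans (by positivity)

lemma le_dimH_Kset : ENNReal.ofReal (5 / 19) ≤ dimH Kset := by
  set I : Set ℝ := Icc 0 (rowWeight (10 / 19) (0, 1)) with hI
  set G : ℝ → ℝ := fun t => blockVal (expansionDigit t) with hG
  have hpos : 0 < rowWeight (10 / 19) (0, 1) := rowWeight_pos _ (by simp [rowCone])
  have hinj : InjOn G I := by
    intro t ht t' ht' e
    have h := abs_sub_le_abs_blockVal_sub_rpow ht ht'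
    have e' : blockVal (expansionDigit t) = blockVal (expansionDigit t') := e
    rw [e', sub_self, abs_zero, Real.zero_rpow (by norm_num), mul_zero] at h
    exact sub_eq_zero.1 (abs_nonpos_iff.1 h)
  have hcoe : ((Real.toNNReal (5 / 19) : ℝ≥0) : ℝ) = 5 / 19 := Real.coe_toNNReal _ (by norm_num)
  have hhol : HolderOnWith (Real.toNNReal (56 ^ (5 / 19 : ℝ))) (Real.toNNReal (5 / 19))
      (Function.invFunOn G I) (G '' I) := by
    rintro _ ⟨t, ht, rfl⟩ _ ⟨t', ht', rfl⟩
    rw [hinj.leftInvOn_invFunOn ht, hinj.leftInvOn_invFunOn ht', edist_dist, edist_dist, hcoe,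
      ENNReal.ofReal_rpow_of_nonneg dist_nonneg (by norm_num)]
    change _ ≤ ENNReal.ofReal _ * _
    rw [← ENNReal.ofReal_mul (by positivity)]
    exact ENNReal.ofReal_le_ofReal (abs_sub_le_abs_blockVal_sub_rpow ht ht')
  have himg : Function.invFunOn G I '' (G '' I) = I := hinj.leftInvOn_invFunOn.image_image
  have hdim := hhol.dimH_image_le (by norm_num)
  have hI1 : dimH I = 1 := by
    have := Real.dimH_of_nonempty_interior (E := ℝ) (s := I)
      (by rw [hI, interior_Icc]; exact nonempty_Ioo.2 hpos)
    simpa using this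
  rw [himg, hI1, ENNReal.le_div_iff_mul_le (by left; norm_num) (by left; simp), one_mul] at hdim
  refine hdim.trans (dimH_mono ?_)
  rw [Kset_eq_range]
  rintro _ ⟨t, _, rfl⟩
  exact ⟨_, rfl⟩

/-- `0.2628 < HD(K({1_2, 2_2})) < 0.2646`. -/
theorem hd_K_bounds :
    ENNReal.ofReal 0.2628 < dimH Kset ∧ dimH Kset < ENNReal.ofReal 0.2646 := by
  constructor
  · exact ((ENNReal.ofReal_lt_ofReal_iff (by norm_num)).2 (by norm_num)).trans_le le_dimH_Kset
  · exact dimH_Kset_le.trans_lt ((ENNReal.ofReal_lt_ofReal_iff (by norm_num)).2 (by norm_num))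
end
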